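/- Let U be an invertible matrix over Γ_an,con. Then there exist a matrix V = 1 + Σ_{n=1}^∞ V_n t^n with entries in Ω_an which is invertible over Ω_an, and a matrix W with entries in Γ_con[1/p], such that U = VW. -/

import Mathlib

open scoped Classical

/-- The analytic setting.  `F = O[1/p]` is the fraction field of a complete discrete
valuation ring `O` which is a finite totally ramified extension of the Witt vectors of an
algebraically closed field `k` of characteristic `p` (encoded via the absolute value `abv`
with `abv p = 1/p`, discreteness, completeness, and algebraically closed residue field),
equipped with a Frobenius lift `σF`.  `Γac = Γ_{an,con}` is the ring of series
`∑_{n ∈ ℤ} cₙ tⁿ` with `cₙ ∈ F` such that `limsup_{n→+∞} |cₙ|^{1/n} ≤ 1` and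
`|cₙ| ≤ p^{cn+d}` for all `n < 0`, for some constants `c, d > 0`; it is encoded by its
coefficient functionals `coeff`, and carries the standard Frobenius `frob = σ_t`
(acting by `σ` on coefficients and sending `t` to `t^p`). -/
structure AnSetting (p : ℕ) [Fact p.Prime] where
  F : Type
  [fieldF : Field F]
  abv : F → ℝ
  abv_nonneg : ∀ x, 0 ≤ abv x
  abv_eq_zero : ∀ x, abv x = 0 ↔ x = 0
  abv_mul : ∀ x y, abv (x * y) = abv x * abv y
  abv_add_le : ∀ x y, abv (x + y) ≤ max (abv x) (abv y)
  abv_p : abv (p : F) = (p : ℝ)⁻¹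
  m : ℕ
  m_pos : 0 < m
  abv_discrete : ∀ x : F, x ≠ 0 → ∃ n : ℤ, abv x = (p : ℝ) ^ ((n : ℝ) / (m : ℝ))
  complete : ∀ f : ℕ → F,
    (∀ ε : ℝ, 0 < ε → ∃ N, ∀ a ≥ N, ∀ b ≥ N, abv (f a - f b) < ε) →
    ∃ x : F, ∀ ε : ℝ, 0 < ε → ∃ N, ∀ a ≥ N, abv (f a - x) < ε
  residue_algClosed : ∀ f : Polynomial F, f.Monic → (∀ i, abv (f.coeff i) ≤ 1) →
    0 < f.natDegree → ∃ x : F, abv x ≤ 1 ∧ abv (Polynomial.eval x f) < 1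
  σF : F ≃+* F
  abv_σF : ∀ x, abv (σF x) = abv x
  σF_frob : ∀ x : F, abv x ≤ 1 → abv (σF x - x ^ p) < 1
  Γac : Type
  [commΓac : CommRing Γac]
  coeff : Γac → ℤ → F
  coeff_injective : Function.Injective coeff
  coeff_add : ∀ x y i, coeff (x + y) i = coeff x i + coeff y i
  coeff_growth : ∀ (x : Γac) (ε : ℝ), 0 < ε → ∃ N : ℤ, 0 ≤ N ∧
    ∀ n : ℤ, N ≤ n → abv (coeff x n) ≤ (1 + ε) ^ n
  coeff_decay : ∀ x : Γac, ∃ c d : ℝ, 0 < c ∧ 0 < d ∧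
    ∀ n : ℤ, n < 0 → abv (coeff x n) ≤ (p : ℝ) ^ (c * (n : ℝ) + d)
  coeff_surjective : ∀ f : ℤ → F,
    (∀ ε : ℝ, 0 < ε → ∃ N : ℤ, 0 ≤ N ∧ ∀ n : ℤ, N ≤ n → abv (f n) ≤ (1 + ε) ^ n) →
    (∃ c d : ℝ, 0 < c ∧ 0 < d ∧ ∀ n : ℤ, n < 0 → abv (f n) ≤ (p : ℝ) ^ (c * (n : ℝ) + d)) →
    ∃ x, coeff x = f
  coeff_one : ∀ i, coeff 1 i = if i = 0 then 1 else 0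
  t : Γac
  coeff_t : ∀ i, coeff t i = if i = 1 then 1 else 0
  const : F →+* Γac
  coeff_const : ∀ a i, coeff (const a) i = if i = 0 then a else 0
  coeff_mul : ∀ (x y : Γac) (n : ℤ) (ε : ℝ), 0 < ε →
    ∃ S : Finset ℤ, ∀ T : Finset ℤ, S ⊆ T →
      abv (coeff (x * y) n - ∑ i ∈ T, coeff x i * coeff y (n - i)) < ε
  frob : Γac →+* Γac
  coeff_frob : ∀ x n, coeff (frob x) n =
    if (p : ℤ) ∣ n then σF (coeff x (n / (p : ℤ))) else 0

attribute [instance] AnSetting.fieldF AnSetting.commΓac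

namespace AnSetting

variable {p : ℕ} [Fact p.Prime] (S : AnSetting p)

/-- The subring `Ω_an ⊆ Γ_{an,con}` of rigid analytic functions on the open unit disc
(series with no negative-index coefficients), as a set. -/
def omegaAnSet : Set S.Γac := {x | ∀ i : ℤ, i < 0 → S.coeff x i = 0}

/-- The subring `Γ_con[1/p] ⊆ Γ_{an,con}`: the elements whose coefficients are bounded
above, as a set. -/
def conPSet : Set S.Γac := {x | ∃ C : ℝ, ∀ i : ℤ, S.abv (S.coeff x i) ≤ C}

/-- The subring `Γ_con ⊆ Γ_{an,con}`: the elements with integral coefficients, as a set. -/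
def conSet : Set S.Γac := {x | ∀ i : ℤ, S.abv (S.coeff x i) ≤ 1}

/-- The subring `Ω = O[[t]] ⊆ Γ_{an,con}`, as a set. -/
def omegaSet : Set S.Γac := {x | (∀ i : ℤ, S.abv (S.coeff x i) ≤ 1) ∧ ∀ i : ℤ, i < 0 → S.coeff x i = 0}

end AnSetting

namespace ANS

variable {p : ℕ} [Fact p.Prime] {S : AnSetting p}

/-! ### The absolute value -/

lemma abv_zero : S.abv 0 = 0 := (S.abv_eq_zero 0).2 rfl

lemma abv_one : S.abv 1 = 1 := by
  have h := S.abv_mul 1 1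
  have h0 : S.abv 1 ≠ 0 := fun h => one_ne_zero ((S.abv_eq_zero 1).1 h)
  rw [mul_one] at h
  exact (mul_left_cancel₀ h0 (by rw [← h, mul_one])).symm

lemma abv_neg (x : S.F) : S.abv (-x) = S.abv x := by
  have h1 : S.abv (-1) = 1 := by
    have h := S.abv_mul (-1) (-1)
    rw [neg_mul_neg, one_mul, abv_one] at h
    nlinarith [S.abv_nonneg (-1)]
  rw [← neg_one_mul, S.abv_mul, h1, one_mul]

lemma abv_sub_le (x y : S.F) : S.abv (x - y) ≤ max (S.abv x) (S.abv y) := by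
  rw [sub_eq_add_neg, ← abv_neg y]; exact S.abv_add_le _ _

lemma abv_pos {x : S.F} (h : x ≠ 0) : 0 < S.abv x :=
  lt_of_le_of_ne (S.abv_nonneg x) fun e => h ((S.abv_eq_zero x).1 e.symm)

lemma abv_inv_mul {x : S.F} (h : x ≠ 0) : S.abv x⁻¹ * S.abv x = 1 := by
  rw [← S.abv_mul, inv_mul_cancel₀ h, abv_one]

lemma abv_sum_le {ι : Type*} (s : Finset ι) (f : ι → S.F) {B : ℝ} (hB : 0 ≤ B)
    (h : ∀ i ∈ s, S.abv (f i) ≤ B) : S.abv (∑ i ∈ s, f i) ≤ B := by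
  induction s using Finset.induction_on with
  | empty => simpa [abv_zero] using hB
  | insert a s ha ih =>
    rw [Finset.sum_insert ha]
    exact (S.abv_add_le _ _).trans (max_le (h _ (Finset.mem_insert_self _ _))
      (ih fun i hi => h i (Finset.mem_insert_of_mem hi)))

lemma abv_sum_lt {ι : Type*} (s : Finset ι) (f : ι → S.F) {B : ℝ} (hB : 0 < B)
    (h : ∀ i ∈ s, S.abv (f i) < B) : S.abv (∑ i ∈ s, f i) < B := by
  induction s using Finset.induction_on with
  | empty => simpa [abv_zero] using hB
  | insert a s ha ih =>
    rw [Finset.sum_insert ha]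
    exact (S.abv_add_le _ _).trans_lt (max_lt (h _ (Finset.mem_insert_self _ _))
      (ih fun i hi => h i (Finset.mem_insert_of_mem hi)))

lemma abv_ge_of_sub_lt {x y : S.F} (h : S.abv (x - y) < S.abv y) : S.abv y ≤ S.abv x := by
  by_contra hc
  push Not at hc
  have h1 := abv_sub_le x (x - y)
  rw [sub_sub_cancel] at h1
  exact absurd h1 (not_le.2 (max_lt hc h))

/-! ### Coefficients -/

/-- The coefficient functional as an additive map. -/
noncomputable def cf (S : AnSetting p) (i : ℤ) : S.Γac →+ S.F where
  toFun x := S.coeff x i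
  map_zero' := by
    have h := S.coeff_add 0 0 i
    rw [add_zero] at h
    simpa using h
  map_add' x y := S.coeff_add x y i

lemma cf_apply (i : ℤ) (x : S.Γac) : cf S i x = S.coeff x i := rfl

lemma ext {x y : S.Γac} (h : ∀ i, S.coeff x i = S.coeff y i) : x = y :=
  S.coeff_injective (funext h)

lemma coeff_zero (i : ℤ) : S.coeff 0 i = 0 := (cf S i).map_zero
lemma coeff_neg (x : S.Γac) (i : ℤ) : S.coeff (-x) i = - S.coeff x i := (cf S i).map_neg x
lemma coeff_sub (x y : S.Γac) (i : ℤ) : S.coeff (x - y) i = S.coeff x i - S.coeff y i :=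
  (cf S i).map_sub x y
lemma coeff_sum {ι : Type*} (s : Finset ι) (f : ι → S.Γac) (i : ℤ) :
    S.coeff (∑ j ∈ s, f j) i = ∑ j ∈ s, S.coeff (f j) i := map_sum (cf S i) f s

lemma eq_of_abv_lt {x y : S.F} (h : ∀ ε : ℝ, 0 < ε → S.abv (x - y) < ε) : x = y := by
  by_contra hc
  exact lt_irrefl _ (h _ (abv_pos (sub_ne_zero.2 hc)))

lemma coeff_mul_eq {x y : S.Γac} {n : ℤ} {c : S.F} (S0 : Finset ℤ)
    (h : ∀ T : Finset ℤ, S0 ⊆ T → ∑ i ∈ T, S.coeff x i * S.coeff y (n - i) = c) :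
    S.coeff (x * y) n = c := by
  apply eq_of_abv_lt
  intro ε hε
  obtain ⟨S1, h1⟩ := S.coeff_mul x y n ε hε
  have := h1 (S0 ∪ S1) Finset.subset_union_right
  rwa [h _ Finset.subset_union_left] at this

/-! ### Bounds on circles -/

/-- `x` has Gauss norm at most `C` on the circle of radius `r`. -/
def Bd (r C : ℝ) (x : S.Γac) : Prop := ∀ i : ℤ, S.abv (S.coeff x i) * r ^ i ≤ C

lemma Bd.mono {r C C' : ℝ} {x : S.Γac} (h : Bd r C x) (hC : C ≤ C') : Bd r C' x :=
  fun i => (h i).trans hC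

lemma Bd.nonneg {r C : ℝ} {x : S.Γac} (h : Bd r C x) (hr : 0 < r) : 0 ≤ C :=
  (mul_nonneg (S.abv_nonneg _) (zpow_pos hr 0).le).trans (h 0)

lemma Bd.add {r C : ℝ} {x y : S.Γac} (hr : 0 < r) (hx : Bd r C x) (hy : Bd r C y) :
    Bd r C (x + y) := fun i => by
  rw [S.coeff_add]
  have := zpow_pos hr i
  refine (mul_le_mul_of_nonneg_right (S.abv_add_le _ _) this.le).trans ?_
  rw [max_mul_of_nonneg _ _ this.le]
  exact max_le (hx i) (hy i)

lemma Bd.neg {r C : ℝ} {x : S.Γac} (hx : Bd r C x) : Bd r C (-x) := fun i => by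
  rw [coeff_neg, abv_neg]; exact hx i

lemma Bd.sub {r C : ℝ} {x y : S.Γac} (hr : 0 < r) (hx : Bd r C x) (hy : Bd r C y) :
    Bd r C (x - y) := by
  rw [sub_eq_add_neg]; exact hx.add hr hy.neg

lemma Bd.zero {r C : ℝ} (hC : 0 ≤ C) : Bd r C (0 : S.Γac) := fun i => by
  rw [coeff_zero, abv_zero, zero_mul]; exact hC

lemma Bd.sum {ι : Type*} {r C : ℝ} (hr : 0 < r) (hC : 0 ≤ C) (s : Finset ι) (f : ι → S.Γac)
    (h : ∀ i ∈ s, Bd r C (f i)) : Bd r C (∑ i ∈ s, f i) := by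
  induction s using Finset.induction_on with
  | empty => simpa using Bd.zero hC
  | insert a s ha ih =>
    rw [Finset.sum_insert ha]
    exact (h _ (Finset.mem_insert_self _ _)).add hr
      (ih fun i hi => h i (Finset.mem_insert_of_mem hi))

lemma Bd.mul {r A B : ℝ} {x y : S.Γac} (hr : 0 < r) (hx : Bd r A x) (hy : Bd r B y) :
    Bd r (A * B) (x * y) := fun n => by
  have hA := hx.nonneg hr
  have hB := hy.nonneg hr
  have hn := zpow_pos hr n
  rw [← le_div_iff₀ hn]
  refine le_of_forall_gt fun c hc => ?_
  have hq : 0 ≤ A * B / r ^ n := by positivity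
  obtain ⟨S1, h1⟩ := S.coeff_mul x y n c (hq.trans_lt hc)
  have h2 := h1 S1 subset_rfl
  have h3 : S.abv (∑ i ∈ S1, S.coeff x i * S.coeff y (n - i)) ≤ A * B / r ^ n := by
    refine abv_sum_le _ _ hq fun i _ => ?_
    rw [le_div_iff₀ hn, S.abv_mul]
    have e : r ^ n = r ^ i * r ^ (n - i) := by rw [← zpow_add₀ hr.ne']; congr 1; ring
    rw [e, mul_mul_mul_comm]
    exact mul_le_mul (hx i) (hy _) (mul_nonneg (S.abv_nonneg _) (zpow_pos hr _).le) hA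
  have h4 := S.abv_add_le (S.coeff (x * y) n - ∑ i ∈ S1, S.coeff x i * S.coeff y (n - i))
    (∑ i ∈ S1, S.coeff x i * S.coeff y (n - i))
  rw [sub_add_cancel] at h4
  exact h4.trans_lt (max_lt h2 (h3.trans_lt hc))

lemma eq_zero_of_Bd {r : ℝ} (hr : 0 < r) {x : S.Γac} (h : ∀ ε : ℝ, 0 < ε → Bd r ε x) : x = 0 := by
  apply ext
  intro i
  rw [coeff_zero, ← S.abv_eq_zero]
  refine le_antisymm ?_ (S.abv_nonneg _)
  refine le_of_forall_gt fun c hc => ?_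
  have h1 := h (c / 2 * r ^ i) (by positivity) i
  have := le_of_mul_le_mul_right h1 (zpow_pos hr i)
  linarith

end ANS

namespace ANS

open Filter Topology

variable {p : ℕ} [Fact p.Prime] {S : AnSetting p}

lemma one_lt_p (p : ℕ) [Fact p.Prime] : (1 : ℝ) < p := by
  exact_mod_cast (Fact.out : p.Prime).one_lt

lemma ev_Ioo {a : ℝ} (ha : a < 1) : ∀ᶠ r in 𝓝[<] (1 : ℝ), a < r ∧ r < 1 :=
  Ioo_mem_nhdsLT ha

lemma ev_bd (x : S.Γac) : ∀ᶠ r in 𝓝[<] (1 : ℝ), ∃ C, Bd r C x := by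
  have hp := one_lt_p p
  have hp0 : (0 : ℝ) < p := by linarith
  obtain ⟨c, d, hc, hd, hcd⟩ := S.coeff_decay x
  have h1 : (p : ℝ) ^ (-c) < 1 := Real.rpow_lt_one_of_one_lt_of_neg hp (by linarith)
  have h0 : (0 : ℝ) < (p : ℝ) ^ (-c) := Real.rpow_pos_of_pos hp0 _
  filter_upwards [ev_Ioo h1] with r hr
  have hr0 : 0 < r := h0.trans hr.1
  have hε : 0 < 1 / r - 1 := by
    rw [sub_pos, lt_div_iff₀ hr0]; linarith [hr.2]
  obtain ⟨N, hN0, hN⟩ := S.coeff_growth x _ hε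
  have hs : 0 ≤ ∑ i ∈ Finset.Ico 0 N, S.abv (S.coeff x i) * r ^ i :=
    Finset.sum_nonneg fun i _ => mul_nonneg (S.abv_nonneg _) (zpow_pos hr0 _).le
  have hpd : 0 < (p : ℝ) ^ d := Real.rpow_pos_of_pos hp0 _
  refine ⟨(p : ℝ) ^ d + 1 + ∑ i ∈ Finset.Ico 0 N, S.abv (S.coeff x i) * r ^ i, fun n => ?_⟩
  have hrn := zpow_pos hr0 n
  by_cases hn : n < 0
  · have h2 := mul_le_mul_of_nonneg_right (hcd n hn) hrn.le
    have h3 : (p : ℝ) ^ (c * (n : ℝ) + d) * r ^ n = (p : ℝ) ^ d * ((p : ℝ) ^ c * r) ^ n := by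
      rw [Real.rpow_add hp0, Real.rpow_mul hp0.le, Real.rpow_intCast, mul_zpow]; ring
    have h4 : 1 ≤ (p : ℝ) ^ c * r := by
      rw [Real.rpow_neg hp0.le] at hr
      have := mul_lt_mul_of_pos_left hr.1 (Real.rpow_pos_of_pos hp0 c)
      rw [mul_inv_cancel₀ (Real.rpow_pos_of_pos hp0 c).ne'] at this
      exact this.le
    have h5 : ((p : ℝ) ^ c * r) ^ n ≤ 1 := zpow_le_one_of_nonpos₀ h4 hn.le
    have h6 := mul_le_mul_of_nonneg_left h5 hpd.le
    linarith
  · push Not at hn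
    by_cases hnN : N ≤ n
    · have h2 := mul_le_mul_of_nonneg_right (hN n hnN) hrn.le
      have h3 : (1 + (1 / r - 1)) ^ n * r ^ n = 1 := by
        rw [← mul_zpow]
        have : (1 + (1 / r - 1)) * r = 1 := by field_simp; ring
        rw [this, one_zpow]
      linarith
    · push Not at hnN
      have := Finset.single_le_sum (f := fun i => S.abv (S.coeff x i) * r ^ i)
        (s := Finset.Ico 0 N)
        (fun i _ => mul_nonneg (S.abv_nonneg _) (zpow_pos hr0 _).le)
        (Finset.mem_Ico.2 ⟨hn, hnN⟩)
      linarith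

lemma surj (f : ℤ → S.F)
    (h : ∀ᶠ r in 𝓝[<] (1 : ℝ), ∃ C, ∀ i, S.abv (f i) * r ^ i ≤ C) : ∃ x, S.coeff x = f := by
  have hp := one_lt_p p
  have hp0 : (0 : ℝ) < p := by linarith
  apply S.coeff_surjective
  · intro ε hε
    have h1 : 1 / (1 + ε) < 1 := by rw [div_lt_one (by linarith)]; linarith
    obtain ⟨r, ⟨C, hC⟩, hr1, hr2⟩ := (h.and (ev_Ioo h1)).exists
    have hr0 : 0 < r := lt_trans (by positivity) hr1
    have hq : 1 < r * (1 + ε) := by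
      rwa [div_lt_iff₀ (by linarith)] at hr1
    obtain ⟨N, hN⟩ := pow_unbounded_of_one_lt C hq
    refine ⟨N, by positivity, fun n hn => ?_⟩
    have h2 : C ≤ (r * (1 + ε)) ^ n := by
      refine hN.le.trans ?_
      rw [← zpow_natCast]
      exact zpow_le_zpow_right₀ hq.le hn
    have h3 := (hC n).trans h2
    rw [mul_zpow, mul_comm] at h3
    exact le_of_mul_le_mul_left h3 (zpow_pos hr0 n)
  · obtain ⟨r, ⟨C, hC⟩, hr0, hr1⟩ := (h.and (ev_Ioo zero_lt_one)).exists
    refine ⟨-Real.logb p r, Real.logb p (max C p), ?_, ?_, fun n _ => ?_⟩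
    · rw [neg_pos]; exact Real.logb_neg hp hr0 hr1
    · exact Real.logb_pos hp (lt_max_of_lt_right hp)
    · rw [Real.rpow_add hp0, Real.rpow_logb hp0 hp.ne' (lt_max_of_lt_right hp0),
        Real.rpow_mul hp0.le, Real.rpow_neg hp0.le, Real.rpow_logb hp0 hp.ne' hr0,
        Real.rpow_intCast, inv_zpow, ← div_eq_inv_mul, le_div_iff₀ (zpow_pos hr0 n)]
      exact (hC n).trans (le_max_left _ _)

/-! ### Projections and monomials -/

lemma proj_exists (s : Set ℤ) (x : S.Γac) :
    ∃ y : S.Γac, S.coeff y = fun i => if i ∈ s then S.coeff x i else 0 := by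
  apply surj
  filter_upwards [ev_bd x, ev_Ioo zero_lt_one] with r ⟨C, hC⟩ hr
  refine ⟨C, fun i => ?_⟩
  split_ifs
  · exact hC i
  · rw [abv_zero, zero_mul]; exact hC.nonneg hr.1

/-- Projection to the part of a series supported on `s`. -/
noncomputable def proj (s : Set ℤ) : S.Γac →+ S.Γac where
  toFun x := (proj_exists s x).choose
  map_zero' := ext fun i => by
    rw [(proj_exists s 0).choose_spec]; simp [coeff_zero]
  map_add' x y := ext fun i => by
    rw [S.coeff_add, (proj_exists s (x + y)).choose_spec, (proj_exists s x).choose_spec,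
      (proj_exists s y).choose_spec]
    dsimp only
    split_ifs <;> simp [S.coeff_add]

lemma coeff_proj (s : Set ℤ) (x : S.Γac) (i : ℤ) :
    S.coeff (proj s x) i = if i ∈ s then S.coeff x i else 0 := by
  have := (proj_exists s x).choose_spec
  exact congrFun this i

lemma Bd.proj {r C : ℝ} {x : S.Γac} (hr : 0 < r) (h : Bd r C x) (s : Set ℤ) :
    Bd r C (proj s x) := fun i => by
  rw [coeff_proj]
  split_ifs
  · exact h i
  · rw [abv_zero, zero_mul]; exact h.nonneg hr

lemma mono_exists (a : S.F) (N : ℤ) : ∃ y : S.Γac, S.coeff y = fun i => if i = N then a else 0 := by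
  apply surj
  filter_upwards [ev_Ioo zero_lt_one] with r hr
  refine ⟨S.abv a * r ^ N, fun i => ?_⟩
  have := mul_nonneg (S.abv_nonneg a) (zpow_pos hr.1 N).le
  split_ifs with h
  · rw [h]
  · rwa [abv_zero, zero_mul]

/-- The monomial `a t^N`. -/
noncomputable def mono (S : AnSetting p) (a : S.F) (N : ℤ) : S.Γac := (mono_exists a N).choose

lemma coeff_mono (a : S.F) (N i : ℤ) : S.coeff (mono S a N) i = if i = N then a else 0 :=
  congrFun (mono_exists a N).choose_spec i

lemma Bd_mono {r : ℝ} (hr : 0 < r) (a : S.F) (N : ℤ) : Bd r (S.abv a * r ^ N) (mono S a N) :=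
  fun i => by
    have := mul_nonneg (S.abv_nonneg a) (zpow_pos hr N).le
    rw [coeff_mono]
    split_ifs with h
    · rw [h]
    · rwa [abv_zero, zero_mul]

lemma coeff_mono_mul (a : S.F) (N : ℤ) (x : S.Γac) (n : ℤ) :
    S.coeff (mono S a N * x) n = a * S.coeff x (n - N) := by
  apply coeff_mul_eq {N}
  intro T hT
  rw [Finset.sum_eq_single N]
  · rw [coeff_mono, if_pos rfl]
  · intro i _ hi
    rw [coeff_mono, if_neg hi, zero_mul]
  · intro h; exact absurd (hT (Finset.mem_singleton_self N)) h

lemma const_eq (a : S.F) : S.const a = mono S a 0 := ext fun i => by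
  rw [S.coeff_const, coeff_mono]

lemma t_eq : S.t = mono S 1 1 := ext fun i => by
  rw [S.coeff_t, coeff_mono]

lemma one_eq : (1 : S.Γac) = mono S 1 0 := ext fun i => by
  rw [S.coeff_one, coeff_mono]

lemma mono_mul_mono (a b : S.F) (M N : ℤ) : mono S a M * mono S b N = mono S (a * b) (M + N) :=
  ext fun i => by
    rw [coeff_mono_mul, coeff_mono, coeff_mono]
    by_cases h : i = M + N
    · rw [if_pos h, if_pos (by omega)]
    · rw [if_neg h, if_neg (by omega), mul_zero]

lemma coeff_const_mul (a : S.F) (x : S.Γac) (n : ℤ) :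
    S.coeff (S.const a * x) n = a * S.coeff x n := by
  rw [const_eq, coeff_mono_mul, sub_zero]

lemma Bd_one {r : ℝ} (hr : 0 < r) : Bd r 1 (1 : S.Γac) := by
  have := Bd_mono (S := S) hr 1 0
  rwa [abv_one, zpow_zero, one_mul, ← one_eq] at this

/-! ### Subrings -/

/-- `Ω_an` as a subring. -/
def Om (S : AnSetting p) : Subring S.Γac where
  carrier := S.omegaAnSet
  mul_mem' := fun {x y} hx hy n hn => by
    apply coeff_mul_eq ∅
    intro T _
    refine Finset.sum_eq_zero fun i _ => ?_
    by_cases hi : i < 0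
    · rw [hx i hi, zero_mul]
    · rw [hy (n - i) (by omega), mul_zero]
  one_mem' := fun i hi => by rw [S.coeff_one, if_neg hi.ne]
  add_mem' := fun {x y} hx hy i hi => by rw [S.coeff_add, hx i hi, hy i hi, add_zero]
  zero_mem' := fun i _ => coeff_zero i
  neg_mem' := fun {x} hx i hi => by rw [coeff_neg, hx i hi, neg_zero]

lemma mem_Om {x : S.Γac} : x ∈ Om S ↔ ∀ i : ℤ, i < 0 → S.coeff x i = 0 := Iff.rfl

lemma conP_iff {x : S.Γac} : x ∈ S.conPSet ↔ ∃ C, Bd 1 C x := by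
  constructor
  · rintro ⟨C, hC⟩
    exact ⟨C, fun i => by rw [one_zpow, mul_one]; exact hC i⟩
  · rintro ⟨C, hC⟩
    exact ⟨C, fun i => by simpa using hC i⟩

/-- `Γ_con[1/p]` as a subring. -/
def En (S : AnSetting p) : Subring S.Γac where
  carrier := S.conPSet
  mul_mem' := fun {x y} hx hy => by
    obtain ⟨A, hA⟩ := conP_iff.1 hx
    obtain ⟨B, hB⟩ := conP_iff.1 hy
    exact conP_iff.2 ⟨_, hA.mul one_pos hB⟩
  one_mem' := conP_iff.2 ⟨1, Bd_one one_pos⟩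
  add_mem' := fun {x y} hx hy => by
    obtain ⟨A, hA⟩ := conP_iff.1 hx
    obtain ⟨B, hB⟩ := conP_iff.1 hy
    exact conP_iff.2 ⟨max A B, (hA.mono (le_max_left _ _)).add one_pos (hB.mono (le_max_right _ _))⟩
  zero_mem' := conP_iff.2 ⟨0, Bd.zero le_rfl⟩
  neg_mem' := fun {x} hx => by
    obtain ⟨A, hA⟩ := conP_iff.1 hx
    exact conP_iff.2 ⟨A, hA.neg⟩

lemma mem_En {x : S.Γac} : x ∈ En S ↔ ∃ C, Bd 1 C x := conP_iff

lemma mono_mem_En (a : S.F) (N : ℤ) : mono S a N ∈ En S := mem_En.2 ⟨_, Bd_mono one_pos a N⟩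

lemma mono_mem_Om (a : S.F) {N : ℤ} (hN : 0 ≤ N) : mono S a N ∈ Om S := fun i hi => by
  rw [coeff_mono, if_neg (by omega)]

lemma coeff_zero_mul {x y : S.Γac} (hx : x ∈ Om S) (hy : y ∈ Om S) :
    S.coeff (x * y) 0 = S.coeff x 0 * S.coeff y 0 := by
  apply coeff_mul_eq {0}
  intro T hT
  rw [Finset.sum_eq_single 0]
  · rw [sub_zero]
  · intro i _ hi
    rcases lt_or_gt_of_ne hi with h | h
    · rw [hx i h, zero_mul]
    · rw [hy (0 - i) (by omega), mul_zero]
  · intro h; exact absurd (hT (Finset.mem_singleton_self 0)) h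

end ANS

namespace ANS

open Filter Topology

variable {p : ℕ} [Fact p.Prime] {S : AnSetting p}

/-! ### Convergent sums -/

lemma Bd_partial {z : ℕ → S.Γac} {r C θ : ℝ} (hr : 0 < r) (h0 : 0 ≤ θ) (h1 : θ < 1)
    (hz : ∀ k, Bd r (C * θ ^ k) (z k)) {k a : ℕ} (hka : k ≤ a) :
    Bd r (C * θ ^ k) (∑ j ∈ Finset.range a, z j - ∑ j ∈ Finset.range k, z j) := by
  rw [← Finset.sum_Ico_eq_sub _ hka]
  have hC : 0 ≤ C := by simpa using (hz 0).nonneg hr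
  refine Bd.sum hr (by positivity) _ _ fun j hj => (hz j).mono ?_
  exact mul_le_mul_of_nonneg_left (pow_le_pow_of_le_one h0 h1.le (Finset.mem_Ico.1 hj).1) hC

lemma sum_exists (z : ℕ → S.Γac)
    (h : ∀ᶠ r in 𝓝[<] (1 : ℝ), ∃ C θ : ℝ, 0 ≤ θ ∧ θ < 1 ∧ ∀ k, Bd r (C * θ ^ k) (z k)) :
    ∃ w : S.Γac, ∀ r C θ : ℝ, 0 < r → 0 ≤ θ → θ < 1 → (∀ k, Bd r (C * θ ^ k) (z k)) →
      ∀ k, Bd r (C * θ ^ k) (w - ∑ j ∈ Finset.range k, z j) := by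
  have hlim : ∀ i : ℤ, ∃ x : S.F, ∀ ε : ℝ, 0 < ε → ∃ N, ∀ a ≥ N,
      S.abv (S.coeff (∑ j ∈ Finset.range a, z j) i - x) < ε := by
    intro i
    apply S.complete
    intro ε hε
    obtain ⟨r, ⟨C, θ, h0, h1, hz⟩, hr0, hr1⟩ := (h.and (ev_Ioo zero_lt_one)).exists
    have hri := zpow_pos hr0 i
    have ht : Tendsto (fun k : ℕ => C * θ ^ k) atTop (𝓝 0) := by
      simpa using (tendsto_pow_atTop_nhds_zero_of_lt_one h0 h1).const_mul C
    obtain ⟨N, hN⟩ := (ht.eventually_lt_const (show 0 < ε * r ^ i by positivity)).exists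
    refine ⟨N, fun a ha b hb => ?_⟩
    have h2 := Bd_partial hr0 h0 h1 hz ha i
    have h3 := Bd_partial hr0 h0 h1 hz hb i
    rw [coeff_sub] at h2 h3
    have h2' := lt_of_mul_lt_mul_right (h2.trans_lt hN) hri.le
    have h3' := lt_of_mul_lt_mul_right (h3.trans_lt hN) hri.le
    have := abv_sub_le (S.coeff (∑ j ∈ Finset.range a, z j) i - S.coeff (∑ j ∈ Finset.range N, z j) i)
      (S.coeff (∑ j ∈ Finset.range b, z j) i - S.coeff (∑ j ∈ Finset.range N, z j) i)
    rw [sub_sub_sub_cancel_right] at this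
    exact this.trans_lt (max_lt h2' h3')
  choose ζ hζ using hlim
  have key : ∀ r C θ : ℝ, 0 < r → 0 ≤ θ → θ < 1 → (∀ k, Bd r (C * θ ^ k) (z k)) →
      ∀ k i, S.abv (ζ i - S.coeff (∑ j ∈ Finset.range k, z j) i) * r ^ i ≤ C * θ ^ k := by
    intro r C θ hr h0 h1 hz k i
    have hri := zpow_pos hr i
    have hC : 0 ≤ C := by simpa using (hz 0).nonneg hr
    rw [← le_div_iff₀ hri]
    refine le_of_forall_gt fun c hc => ?_
    have hc0 : 0 < c := lt_of_le_of_lt (by positivity) hc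
    obtain ⟨N, hN⟩ := hζ i c hc0
    have h2 := hN (max N k) (le_max_left _ _)
    have h3 := Bd_partial hr h0 h1 hz (le_max_right N k) i
    rw [coeff_sub, ← le_div_iff₀ hri] at h3
    have := abv_sub_le
      (S.coeff (∑ j ∈ Finset.range (max N k), z j) i - S.coeff (∑ j ∈ Finset.range k, z j) i)
      (S.coeff (∑ j ∈ Finset.range (max N k), z j) i - ζ i)
    rw [sub_sub_sub_cancel_left] at this
    exact this.trans_lt (max_lt (h3.trans_lt hc) h2)
  obtain ⟨w, hw⟩ := surj ζ (by
    filter_upwards [h, ev_Ioo zero_lt_one] with r ⟨C, θ, h0, h1, hz⟩ hr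
    refine ⟨C, fun i => ?_⟩
    have := key r C θ hr.1 h0 h1 hz 0 i
    simpa [coeff_zero] using this)
  refine ⟨w, fun r C θ hr h0 h1 hz k i => ?_⟩
  rw [coeff_sub, hw]
  exact key r C θ hr h0 h1 hz k i

lemma fixed_point {α β : Type*} [Finite α] [Finite β] (T : Matrix α β S.Γac →+ Matrix α β S.Γac)
    (a : Matrix α β S.Γac)
    (h : ∀ᶠ r in 𝓝[<] (1 : ℝ), ∃ C θ : ℝ, 0 ≤ θ ∧ θ < 1 ∧
      ∀ k i j, Bd r (C * θ ^ k) ((T^[k] a) i j))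
    (r₀ : ℝ) (hr₀ : 0 < r₀)
    (h0 : ∃ C θ : ℝ, 0 ≤ θ ∧ θ < 1 ∧ ∀ k i j, Bd r₀ (C * θ ^ k) ((T^[k] a) i j))
    (K : ℝ) (hT : ∀ x c, (∀ i j, Bd r₀ c (x i j)) → ∀ i j, Bd r₀ (K * c) (T x i j)) :
    ∃ z : Matrix α β S.Γac, z = a + T z ∧
      ∀ r C θ : ℝ, 0 < r → 0 ≤ θ → θ < 1 → (∀ k i j, Bd r (C * θ ^ k) ((T^[k] a) i j)) →
        ∀ i j, Bd r C (z i j) := by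
  have hw : ∀ i j, ∃ w : S.Γac, ∀ r C θ : ℝ, 0 < r → 0 ≤ θ → θ < 1 →
      (∀ k, Bd r (C * θ ^ k) ((T^[k] a) i j)) →
      ∀ k, Bd r (C * θ ^ k) (w - ∑ l ∈ Finset.range k, (T^[l] a) i j) := by
    intro i j
    apply sum_exists
    filter_upwards [h] with r ⟨C, θ, h0, h1, hz⟩
    exact ⟨C, θ, h0, h1, fun k => hz k i j⟩
  choose z hz using hw
  refine ⟨Matrix.of z, ?_, ?_⟩
  · obtain ⟨C, θ, hθ0, hθ1, hb⟩ := h0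
    have hz0 : ∀ k i j, Bd r₀ (C * θ ^ k) ((Matrix.of z - ∑ l ∈ Finset.range k, T^[l] a) i j) := by
      intro k i j
      have := hz i j r₀ C θ hr₀ hθ0 hθ1 (fun k => hb k i j) k
      rwa [Matrix.sub_apply, Matrix.sum_apply]
    have hsum : ∀ k, a + T (∑ l ∈ Finset.range k, T^[l] a) = ∑ l ∈ Finset.range (k + 1), T^[l] a := by
      intro k
      rw [map_sum, Finset.sum_range_succ', add_comm]
      simp only [Function.iterate_succ_apply', Function.iterate_zero, id]
    have ht : Tendsto (fun k : ℕ => max 1 K * C * θ ^ k) atTop (𝓝 0) := by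
      simpa using (tendsto_pow_atTop_nhds_zero_of_lt_one hθ0 hθ1).const_mul (max 1 K * C)
    rw [← sub_eq_zero]
    ext1 i j
    apply eq_zero_of_Bd hr₀
    intro ε hε
    obtain ⟨k, hk⟩ := (ht.eventually_lt_const hε).exists
    have hC : 0 ≤ C := by simpa using (hb 0 i j).nonneg hr₀
    have e : Matrix.of z - (a + T (Matrix.of z)) =
        (Matrix.of z - ∑ l ∈ Finset.range (k + 1), T^[l] a)
        - T (Matrix.of z - ∑ l ∈ Finset.range k, T^[l] a) := by
      rw [map_sub, ← hsum]; abel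
    rw [e, Matrix.sub_apply]
    have hCk : 0 ≤ C * θ ^ k := by positivity
    refine Bd.mono (C := max 1 K * C * θ ^ k) ?_ hk.le
    refine Bd.sub hr₀ ((hz0 (k + 1) i j).mono ?_) ((hT _ _ (hz0 k) i j).mono ?_)
    · have h1 : C * θ ^ (k + 1) ≤ C * θ ^ k :=
        mul_le_mul_of_nonneg_left (pow_le_pow_of_le_one hθ0 hθ1.le (Nat.le_succ k)) hC
      have h2 := mul_le_mul_of_nonneg_right (le_max_left 1 K) hCk
      linarith
    · have h2 := mul_le_mul_of_nonneg_right (le_max_right 1 K) hCk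
      linarith
  · intro r C θ hr hθ0 hθ1 hb i j
    have := hz i j r C θ hr hθ0 hθ1 (fun k => hb k i j) 0
    simpa using this

/-! ### Units are bounded -/

lemma zpow_small {q : ℝ} (h0 : 0 < q) (h1 : q < 1) {ε : ℝ} (hε : 0 < ε) :
    ∃ M : ℤ, 0 ≤ M ∧ ∀ i : ℤ, M ≤ i → q ^ i < ε := by
  obtain ⟨N, hN⟩ := exists_pow_lt_of_lt_one hε h1
  refine ⟨N, by positivity, fun i hi => lt_of_le_of_lt ?_ hN⟩
  rw [← zpow_natCast]
  exact zpow_le_zpow_right_of_le_one₀ h0 h1.le hi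

lemma small_right {r r' C : ℝ} {x : S.Γac} (hr : 0 < r) (hrr : r < r') (h : Bd r' C x)
    {ε : ℝ} (hε : 0 < ε) : ∃ M : ℤ, ∀ i, M ≤ i → S.abv (S.coeff x i) * r ^ i < ε := by
  have hr' := hr.trans hrr
  have hC := h.nonneg hr'
  obtain ⟨M, -, hM⟩ := zpow_small (q := r / r') (by positivity) ((div_lt_one hr').2 hrr)
    (show 0 < ε / (C + 1) by positivity)
  refine ⟨M, fun i hi => ?_⟩
  have e : S.abv (S.coeff x i) * r ^ i = S.abv (S.coeff x i) * r' ^ i * (r / r') ^ i := by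
    rw [div_zpow]; field_simp [(zpow_pos hr' i).ne']
  have h1 := hM i hi
  rw [lt_div_iff₀ (by positivity)] at h1
  have hq : 0 < (r / r') ^ i := zpow_pos (by positivity) _
  have := mul_le_mul_of_nonneg_right (h i) hq.le
  rw [e]; nlinarith

lemma small_left {r r' C : ℝ} {x : S.Γac} (hr' : 0 < r') (hrr : r' < r) (h : Bd r' C x)
    {ε : ℝ} (hε : 0 < ε) : ∃ M : ℤ, ∀ i, i ≤ M → S.abv (S.coeff x i) * r ^ i < ε := by
  have hr := hr'.trans hrr
  have hC := h.nonneg hr'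
  obtain ⟨M, -, hM⟩ := zpow_small (q := r' / r) (by positivity) ((div_lt_one hr).2 hrr)
    (show 0 < ε / (C + 1) by positivity)
  refine ⟨-M, fun i hi => ?_⟩
  have e : S.abv (S.coeff x i) * r ^ i = S.abv (S.coeff x i) * r' ^ i * (r' / r) ^ (-i) := by
    rw [zpow_neg, div_zpow]
    have := (zpow_pos hr i).ne'
    have := (zpow_pos hr' i).ne'
    field_simp
  have h1 := hM (-i) (by omega)
  rw [lt_div_iff₀ (by positivity)] at h1
  have hq : 0 < (r' / r) ^ (-i) := zpow_pos (by positivity) _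
  have := mul_le_mul_of_nonneg_right (h i) hq.le
  rw [e]; nlinarith

/-- The maximum on a circle is attained, and there is a least index attaining it. -/
lemma exists_lead {r₁ r r₂ C₁ C₂ : ℝ} {x : S.Γac} (h0 : 0 < r₁) (h1 : r₁ < r) (h2 : r < r₂)
    (hb1 : Bd r₁ C₁ x) (hb2 : Bd r₂ C₂ x) (hx : x ≠ 0) :
    ∃ n : ℤ, S.coeff x n ≠ 0 ∧
      Bd r (S.abv (S.coeff x n) * r ^ n) x ∧
      ∀ i < n, S.abv (S.coeff x i) * r ^ i < S.abv (S.coeff x n) * r ^ n := by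
  have hr := h0.trans h1
  obtain ⟨i₀, hi₀⟩ : ∃ i, S.coeff x i ≠ 0 := by
    by_contra hc
    push Not at hc
    exact hx (ext fun i => by rw [hc, coeff_zero])
  set g : ℤ → ℝ := fun i => S.abv (S.coeff x i) * r ^ i with hg
  have hpos : 0 < g i₀ := mul_pos (abv_pos hi₀) (zpow_pos hr _)
  obtain ⟨A, hA⟩ := small_left h0 h1 hb1 hpos
  obtain ⟨B, hB⟩ := small_right hr h2 hb2 hpos
  have hne : i₀ ∈ Finset.Icc A B := by
    rw [Finset.mem_Icc]
    constructor
    · by_contra hc; exact lt_irrefl _ (hA i₀ (by omega))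
    · by_contra hc; exact lt_irrefl _ (hB i₀ (by omega))
  obtain ⟨m, hm, hmax⟩ := Finset.exists_max_image (Finset.Icc A B) g ⟨i₀, hne⟩
  have hall : ∀ i, g i ≤ g m := by
    intro i
    by_cases hi : i ∈ Finset.Icc A B
    · exact hmax i hi
    · rw [Finset.mem_Icc, not_and_or] at hi
      refine le_trans (le_of_lt ?_) (hmax i₀ hne)
      rcases hi with hi | hi
      · exact hA i (by omega)
      · exact hB i (by omega)
  have hmpos := hpos.trans_le (hall i₀)
  obtain ⟨n, hn, hleast⟩ := Int.exists_least_of_bdd (P := fun i => g i = g m)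
    ⟨A, fun z hz => by
      by_contra hc
      have := hA z (by omega)
      change g z < g i₀ at this
      rw [hz] at this
      exact absurd (hall i₀) (not_le.2 this)⟩ ⟨m, rfl⟩
  refine ⟨n, ?_, ?_, ?_⟩
  · intro h
    have : g n = 0 := by simp only [hg, h, abv_zero, zero_mul]
    rw [hn] at this; exact hmpos.ne' this
  · intro i
    change g i ≤ g n
    rw [hn]; exact hall i
  · intro i hi
    change g i < g n
    rw [hn]
    refine lt_of_le_of_ne (hall i) fun e => ?_
    have := hleast i e
    omega

lemma gauss_mul {x y : S.Γac} (hx : x ≠ 0) (hy : y ≠ 0) : ∀ᶠ r in 𝓝[<] (1 : ℝ),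
    ∀ C, Bd r C (x * y) → ∀ i j, (S.abv (S.coeff x i) * r ^ i) * (S.abv (S.coeff y j) * r ^ j) ≤ C := by
  have hE := ((ev_bd x).and (ev_bd y)).and (ev_Ioo zero_lt_one)
  obtain ⟨a, ha, hI⟩ := (mem_nhdsLT_iff_exists_Ioo_subset' (zero_lt_one)).1 hE
  obtain ⟨r₁, ha1, hr11⟩ := exists_between (Set.mem_Iio.1 ha)
  filter_upwards [ev_Ioo hr11] with r hr C hC i j
  obtain ⟨r₂, hr2, hr21⟩ := exists_between hr.2
  obtain ⟨⟨⟨A1, hA1⟩, ⟨B1, hB1⟩⟩, h01, -⟩ := hI (show r₁ ∈ Set.Ioo a 1 from ⟨ha1, hr11⟩)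
  obtain ⟨⟨⟨A2, hA2⟩, ⟨B2, hB2⟩⟩, -, -⟩ :=
    hI (show r₂ ∈ Set.Ioo a 1 from ⟨ha1.trans (hr.1.trans hr2), hr21⟩)
  obtain ⟨m, hm0, hmb, hml⟩ := exists_lead h01 hr.1 hr2 hA1 hA2 hx
  obtain ⟨n, hn0, hnb, hnl⟩ := exists_lead h01 hr.1 hr2 hB1 hB2 hy
  have hr0 := h01.trans hr.1
  have hmp : 0 < S.abv (S.coeff x m) * r ^ m := mul_pos (abv_pos hm0) (zpow_pos hr0 _)
  have hnp : 0 < S.abv (S.coeff y n) * r ^ n := mul_pos (abv_pos hn0) (zpow_pos hr0 _)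
  refine (mul_le_mul (hmb i) (hnb j) (mul_nonneg (S.abv_nonneg _) (zpow_pos hr0 _).le)
    hmp.le).trans ?_
  have hM : 0 < S.abv (S.coeff x m) * S.abv (S.coeff y n) := mul_pos (abv_pos hm0) (abv_pos hn0)
  have hge : S.abv (S.coeff x m) * S.abv (S.coeff y n) ≤ S.abv (S.coeff (x * y) (m + n)) := by
    obtain ⟨S1, h1⟩ := S.coeff_mul x y (m + n) _ hM
    have h2 := h1 (insert m S1) (Finset.subset_insert _ _)
    rw [← Finset.add_sum_erase _ _ (Finset.mem_insert_self m S1), add_sub_cancel_left] at h2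
    have h3 : S.abv (∑ i ∈ (insert m S1).erase m, S.coeff x i * S.coeff y (m + n - i)) <
        S.abv (S.coeff x m) * S.abv (S.coeff y n) := by
      refine abv_sum_lt _ _ hM fun i hi => ?_
      have him := (Finset.mem_erase.1 hi).1
      have hrmn := zpow_pos hr0 (m + n)
      refine lt_of_mul_lt_mul_right (a := r ^ (m + n)) ?_ hrmn.le
      have e1 : S.abv (S.coeff x i * S.coeff y (m + n - i)) * r ^ (m + n) =
          (S.abv (S.coeff x i) * r ^ i) * (S.abv (S.coeff y (m + n - i)) * r ^ (m + n - i)) := by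
        rw [S.abv_mul, mul_mul_mul_comm, ← zpow_add₀ hr0.ne']
        congr 2; ring
      have e2 : S.abv (S.coeff x m) * S.abv (S.coeff y n) * r ^ (m + n) =
          (S.abv (S.coeff x m) * r ^ m) * (S.abv (S.coeff y n) * r ^ n) := by
        rw [mul_mul_mul_comm, ← zpow_add₀ hr0.ne']
      rw [e1, e2]
      rcases lt_or_gt_of_ne him with h | h
      · exact mul_lt_mul_of_lt_of_le_of_nonneg_of_pos (hml i h) (hnb _)
          (mul_nonneg (S.abv_nonneg _) (zpow_pos hr0 _).le) hnp
      · exact (mul_le_mul_of_nonneg_right (hmb i)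
          (mul_nonneg (S.abv_nonneg _) (zpow_pos hr0 _).le)).trans_lt
          (mul_lt_mul_of_pos_left (hnl _ (by omega)) hmp)
    have h4 : S.abv (S.coeff (x * y) (m + n) - S.coeff x m * S.coeff y n) <
        S.abv (S.coeff x m * S.coeff y n) := by
      rw [S.abv_mul]
      have h5 := S.abv_add_le _ _ |>.trans_lt (max_lt h2 h3)
      rwa [sub_add_eq_sub_sub, sub_add_cancel] at h5
    have := abv_ge_of_sub_lt h4
    rwa [S.abv_mul] at this
  have h5 := hC (m + n)
  rw [zpow_add₀ hr0.ne'] at h5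
  have h6 := mul_le_mul_of_nonneg_right hge (mul_pos (zpow_pos hr0 m) (zpow_pos hr0 n)).le
  linarith

lemma bounded_of_mul_eq_one {u v : S.Γac} (h : u * v = 1) : u ∈ En S := by
  have h1 : (1 : S.Γac) ≠ 0 := by
    intro h
    have := S.coeff_one 0
    rw [h, coeff_zero, if_pos rfl] at this
    exact zero_ne_one this
  have hu : u ≠ 0 := by rintro rfl; rw [zero_mul] at h; exact h1 h.symm
  have hv : v ≠ 0 := by rintro rfl; rw [mul_zero] at h; exact h1 h.symm
  obtain ⟨j, hj⟩ : ∃ j, S.coeff v j ≠ 0 := by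
    by_contra hc
    push Not at hc
    exact hv (ext fun i => by rw [hc, coeff_zero])
  refine mem_En.2 ⟨1 / S.abv (S.coeff v j), fun i => ?_⟩
  rw [one_zpow, mul_one, le_div_iff₀ (abv_pos hj)]
  have hev : ∀ᶠ r in 𝓝[<] (1 : ℝ),
      (S.abv (S.coeff u i) * r ^ i) * (S.abv (S.coeff v j) * r ^ j) ≤ 1 := by
    filter_upwards [gauss_mul hu hv, ev_Ioo zero_lt_one] with r hr hr0
    exact hr 1 (by rw [h]; exact Bd_one hr0.1) i j
  have hz : ∀ k : ℤ, Tendsto (fun r : ℝ => r ^ k) (𝓝[<] 1) (𝓝 1) := by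
    intro k
    have := (continuousAt_zpow₀ (1 : ℝ) k (Or.inl one_ne_zero)).tendsto
    rw [one_zpow] at this
    exact this.mono_left nhdsWithin_le_nhds
  have ht := ((hz i).const_mul (S.abv (S.coeff u i))).mul ((hz j).const_mul (S.abv (S.coeff v j)))
  simp only [mul_one] at ht
  exact le_of_tendsto ht hev

end ANS

namespace ANS

open Filter Topology

variable {p : ℕ} [Fact p.Prime] {S : AnSetting p}

lemma Bd_matrix_mul {α β γ : Type*} [Fintype β] {r A B : ℝ} (hr : 0 < r) (hA : 0 ≤ A) (hB : 0 ≤ B)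
    {X : Matrix α β S.Γac} {Y : Matrix β γ S.Γac} (hX : ∀ i j, Bd r A (X i j))
    (hY : ∀ i j, Bd r B (Y i j)) (i : α) (j : γ) : Bd r (A * B) ((X * Y) i j) := by
  rw [Matrix.mul_apply]
  exact Bd.sum hr (mul_nonneg hA hB) _ _ fun k _ => (hX i k).mul hr (hY k j)

/-- The operator `X ↦ -P_s(H X)`. -/
noncomputable def opT {α : Type*} [Fintype α] (s : Set ℤ) (H : Matrix α α S.Γac) :
    Matrix α α S.Γac →+ Matrix α α S.Γac where
  toFun X := -((H * X).map (proj s))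
  map_zero' := by ext1 i j; simp
  map_add' X Y := by
    ext1 i j
    simp only [Matrix.mul_add, Matrix.neg_apply, Matrix.map_apply, Matrix.add_apply, map_add]
    abel

lemma opT_apply {α : Type*} [Fintype α] (s : Set ℤ) (H X : Matrix α α S.Γac) (i j : α) :
    opT s H X i j = - proj s ((H * X) i j) := rfl

lemma opT_bd {α : Type*} [Fintype α] (s : Set ℤ) (H : Matrix α α S.Γac) {r θ : ℝ} (hr : 0 < r)
    (hθ : 0 ≤ θ) (hH : ∀ i j, Bd r θ (H i j)) (X : Matrix α α S.Γac) (c : ℝ)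
    (hX : ∀ i j, Bd r c (X i j)) (i j : α) : Bd r (θ * c) (opT s H X i j) := by
  rw [opT_apply]
  exact ((Bd_matrix_mul hr hθ ((hX i j).nonneg hr) hH hX i j).proj hr s).neg

lemma opT_iter_bd {α : Type*} [Fintype α] (s : Set ℤ) (H : Matrix α α S.Γac) {r θ C : ℝ}
    (hr : 0 < r) (hθ : 0 ≤ θ) (hH : ∀ i j, Bd r θ (H i j)) (X : Matrix α α S.Γac)
    (hX : ∀ i j, Bd r C (X i j)) (k : ℕ) (i j : α) : Bd r (C * θ ^ k) (((opT s H)^[k] X) i j) := by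
  induction k generalizing i j with
  | zero => simpa using hX i j
  | succ k ih =>
    rw [Function.iterate_succ_apply']
    have := opT_bd s H hr hθ hH _ _ ih i j
    rwa [show C * θ ^ (k + 1) = θ * (C * θ ^ k) by ring]

lemma ev_bd_matrix {α β : Type*} [Finite α] [Finite β] (X : Matrix α β S.Γac) :
    ∀ᶠ r in 𝓝[<] (1 : ℝ), ∃ C, 0 ≤ C ∧ ∀ i j, Bd r C (X i j) := by
  have h : ∀ᶠ r in 𝓝[<] (1 : ℝ), ∀ i j, ∃ C, Bd r C (X i j) := by
    rw [eventually_all]; intro i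
    rw [eventually_all]; intro j
    exact ev_bd _
  filter_upwards [h] with r hr
  choose C hC using hr
  cases nonempty_fintype α
  cases nonempty_fintype β
  refine ⟨∑ i, ∑ j, |C i j|, by positivity, fun i j => (hC i j).mono ?_⟩
  calc C i j ≤ |C i j| := le_abs_self _
    _ ≤ ∑ j, |C i j| := Finset.single_le_sum (f := fun j => |C i j|) (fun _ _ => abs_nonneg _)
        (Finset.mem_univ j)
    _ ≤ _ := Finset.single_le_sum (f := fun i => ∑ j, |C i j|)
        (fun _ _ => Finset.sum_nonneg fun _ _ => abs_nonneg _) (Finset.mem_univ i)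

/-- Contraction near the outer boundary. -/
lemma solve_outer (s : Set ℤ) (H f : S.Γac)
    (hH : ∀ᶠ r in 𝓝[<] (1 : ℝ), ∃ θ : ℝ, 0 ≤ θ ∧ θ < 1 ∧ Bd r θ H) :
    ∃ y : S.Γac, y = proj s (f - H * y) := by
  let H' : Matrix Unit Unit S.Γac := Matrix.of fun _ _ => H
  let a : Matrix Unit Unit S.Γac := Matrix.of fun _ _ => proj s f
  have hev : ∀ᶠ r in 𝓝[<] (1 : ℝ), 0 < r ∧ ∃ C θ : ℝ, 0 ≤ θ ∧ θ < 1 ∧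
      (∀ k i j, Bd r (C * θ ^ k) (((opT s H')^[k] a) i j)) ∧ ∀ i j, Bd r θ (H' i j) := by
    filter_upwards [hH, ev_bd_matrix a, ev_Ioo zero_lt_one] with r ⟨θ, h0, h1, h2⟩ ⟨C, _, hC⟩ hr
    exact ⟨hr.1, C, θ, h0, h1, opT_iter_bd s H' hr.1 h0 (fun _ _ => h2) a hC, fun _ _ => h2⟩
  obtain ⟨r, hr0, C, θ, h0, h1, h2, h3⟩ := hev.exists
  obtain ⟨z, hz, -⟩ := fixed_point (opT s H') a
    (hev.mono fun r ⟨_, C, θ, h0, h1, h2, _⟩ => ⟨C, θ, h0, h1, h2⟩) r hr0 ⟨C, θ, h0, h1, h2⟩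
    θ (opT_bd s H' hr0 h0 h3)
  refine ⟨z () (), ?_⟩
  have := congrFun (congrFun hz ()) ()
  rw [Matrix.add_apply, opT_apply, Matrix.mul_apply] at this
  rw [map_sub, sub_eq_add_neg]
  simpa [a, H'] using this

lemma Bd_of_neg_supp {ρ r C : ℝ} {x : S.Γac} (hρ : 0 < ρ) (hr : ρ ≤ r)
    (hx : ∀ i : ℤ, 0 ≤ i → S.coeff x i = 0) (h : Bd ρ C x) : Bd r C x := fun i => by
  by_cases hi : 0 ≤ i
  · rw [hx i hi, abv_zero, zero_mul]; exact h.nonneg hρ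
  · push Not at hi
    refine le_trans (mul_le_mul_of_nonneg_left ?_ (S.abv_nonneg _)) (h i)
    have := zpow_le_zpow_left₀ (show 0 ≤ -i by omega) hρ.le hr
    rw [zpow_neg, zpow_neg] at this
    exact (inv_le_inv₀ (zpow_pos hρ i) (zpow_pos (hρ.trans_le hr) i)).1 this

/-- Contraction on an inner circle, for series in negative powers of `t`. -/
lemma solve_inner {α : Type*} [Fintype α] (H : Matrix α α S.Γac) {ρ c : ℝ} (hρ : 0 < ρ)
    (hρ1 : ρ < 1) (hc0 : 0 ≤ c) (hc1 : c < 1) (hH : ∀ i j, Bd ρ c (H i j)) :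
    ∃ X : Matrix α α S.Γac, (∀ i j, Bd ρ c (X i j)) ∧
      (∀ i j, ∀ k : ℤ, 0 ≤ k → S.coeff (X i j) k = 0) ∧
      ∀ i j, proj (Set.Iio 0) ((H + X + H * X) i j) = 0 := by
  let s : Set ℤ := Set.Iio 0
  have hs : ∀ (x : S.Γac) (k : ℤ), 0 ≤ k → S.coeff (proj s x) k = 0 := by
    intro x k hk
    rw [coeff_proj, if_neg (by simpa [s] using hk)]
  let a : Matrix α α S.Γac := -(H.map (proj s))
  have ha : ∀ i j, Bd ρ c (a i j) := fun i j => ((hH i j).proj hρ s).neg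
  have hk := opT_iter_bd s H hρ hc0 hH a ha
  have hsupp : ∀ k i j, ∀ l : ℤ, 0 ≤ l → S.coeff (((opT s H)^[k] a) i j) l = 0 := by
    intro k i j l hl
    cases k with
    | zero =>
      change S.coeff (- proj s (H i j)) l = 0
      rw [coeff_neg, hs _ _ hl, neg_zero]
    | succ k =>
      rw [Function.iterate_succ_apply', opT_apply, coeff_neg, hs _ _ hl, neg_zero]
  obtain ⟨z, hz, hzb⟩ := fixed_point (opT s H) a (by
    filter_upwards [ev_Ioo hρ1] with r hr
    exact ⟨c, c, hc0, hc1, fun k i j => Bd_of_neg_supp hρ hr.1.le (hsupp k i j) (hk k i j)⟩)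
    ρ hρ ⟨c, c, hc0, hc1, hk⟩ c (opT_bd s H hρ hc0 hH)
  have hzij : ∀ i j, z i j = - proj s ((H + H * z) i j) := by
    intro i j
    have := congrFun (congrFun hz i) j
    rw [Matrix.add_apply, opT_apply] at this
    rw [this, Matrix.add_apply, map_add, neg_add]
    rfl
  have hzs : ∀ i j, ∀ k : ℤ, 0 ≤ k → S.coeff (z i j) k = 0 := by
    intro i j k hk
    rw [hzij, coeff_neg, hs _ _ hk, neg_zero]
  refine ⟨z, hzb ρ c c hρ hc0 hc1 hk, hzs, fun i j => ?_⟩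
  have h1 : proj s (z i j) = z i j := ext fun k => by
    rw [coeff_proj]
    split_ifs with h
    · rfl
    · exact (hzs i j k (by simpa [s] using h)).symm
  have h2 : (H + z + H * z) i j = z i j + (H + H * z) i j := by
    simp only [Matrix.add_apply]; ring
  change proj s _ = 0
  rw [h2, map_add, h1]
  conv_lhs => rw [hzij i j]
  exact neg_add_cancel _

/-! ### Weierstrass theory -/

lemma exists_wdeg {g : S.Γac} (hg : g ∈ En S) (hg0 : g ≠ 0) :
    ∃ N : ℤ, S.coeff g N ≠ 0 ∧ (∀ i, S.abv (S.coeff g i) ≤ S.abv (S.coeff g N)) ∧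
      ∃ η : ℝ, 0 < η ∧ η < 1 ∧ ∀ i < N, S.abv (S.coeff g i) ≤ η * S.abv (S.coeff g N) := by
  have hp := one_lt_p p
  have hp0 : (0 : ℝ) < p := by linarith
  have hm : (0 : ℝ) < S.m := by exact_mod_cast S.m_pos
  obtain ⟨C, hC⟩ := mem_En.1 hg
  obtain ⟨i₁, hi₁⟩ : ∃ i, S.coeff g i ≠ 0 := by
    by_contra hc
    push Not at hc
    exact hg0 (ext fun i => by rw [hc, coeff_zero])
  obtain ⟨n₀, ⟨i₀, hi₀, hn₀⟩, hmax⟩ := Int.exists_greatest_of_bdd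
    (P := fun n : ℤ => ∃ i, S.coeff g i ≠ 0 ∧ S.abv (S.coeff g i) = (p : ℝ) ^ ((n : ℝ) / (S.m : ℝ)))
    ⟨⌈S.m * Real.logb p C⌉, by
      rintro n ⟨i, hi, hn⟩
      have h1 := hC i
      rw [one_zpow, mul_one] at h1
      have h2 := Real.logb_le_logb_of_le hp (abv_pos hi) h1
      rw [hn, Real.logb_rpow hp0 hp.ne', div_le_iff₀ hm] at h2
      have h3 := Int.le_ceil (S.m * Real.logb p C)
      have : (n : ℝ) ≤ (⌈S.m * Real.logb p C⌉ : ℝ) := by linarith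
      exact_mod_cast this⟩
    (by obtain ⟨n, hn⟩ := S.abv_discrete _ hi₁
        exact ⟨n, i₁, hi₁, hn⟩)
  have hle : ∀ i, S.abv (S.coeff g i) ≤ S.abv (S.coeff g i₀) := by
    intro i
    by_cases hi : S.coeff g i = 0
    · rw [hi, abv_zero]; exact S.abv_nonneg _
    · obtain ⟨n, hn⟩ := S.abv_discrete _ hi
      have := hmax n ⟨i, hi, hn⟩
      rw [hn, hn₀]
      apply Real.rpow_le_rpow_of_exponent_le hp.le
      have h' : (n : ℝ) ≤ n₀ := by exact_mod_cast this
      gcongr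
  obtain ⟨r, ⟨D, hD⟩, hr0, hr1⟩ := ((ev_bd g).and (ev_Ioo zero_lt_one)).exists
  obtain ⟨A, hA⟩ := small_left hr0 hr1 hD (abv_pos hi₀)
  obtain ⟨N, hN, hleast⟩ := Int.exists_least_of_bdd
    (P := fun i => S.abv (S.coeff g i) = S.abv (S.coeff g i₀))
    ⟨A, fun z hz => by
      by_contra hc
      have := hA z (by omega)
      rw [one_zpow, mul_one, hz] at this
      exact lt_irrefl _ this⟩ ⟨i₀, rfl⟩
  refine ⟨N, ?_, fun i => by rw [hN]; exact hle i, (p : ℝ) ^ (-(1 / (S.m : ℝ))),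
    Real.rpow_pos_of_pos hp0 _,
    Real.rpow_lt_one_of_one_lt_of_neg hp (by rw [neg_lt_zero]; positivity), fun i hi => ?_⟩
  · intro h
    rw [h, abv_zero] at hN
    exact (abv_pos hi₀).ne hN
  · by_cases hi0 : S.coeff g i = 0
    · rw [hi0, abv_zero]; exact mul_nonneg (Real.rpow_pos_of_pos hp0 _).le (S.abv_nonneg _)
    · obtain ⟨n, hn⟩ := S.abv_discrete _ hi0
      have h1 := hmax n ⟨i, hi0, hn⟩
      have h2 : n ≠ n₀ := by
        rintro rfl
        have := hleast i (by rw [hn, hn₀])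
        omega
      have h3 : n + 1 ≤ n₀ := by omega
      have h3' : (n : ℝ) + 1 ≤ n₀ := by exact_mod_cast h3
      rw [hN, hn, hn₀, ← Real.rpow_add hp0]
      apply Real.rpow_le_rpow_of_exponent_le hp.le
      rw [← neg_div, ← add_div]
      gcongr
      linarith

lemma small_tail {g : S.Γac} {N : ℤ} {η : ℝ} (hη0 : 0 < η) (hη1 : η < 1) (hN : S.coeff g N = 1)
    (h1 : ∀ i, S.abv (S.coeff g i) ≤ 1) (h2 : ∀ i < N, S.abv (S.coeff g i) ≤ η) :
    ∀ᶠ r in 𝓝[<] (1 : ℝ), ∃ θ : ℝ, 0 ≤ θ ∧ θ < 1 ∧ Bd r θ (mono S 1 (-N) * (g - mono S 1 N)) := by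
  obtain ⟨r₁, ⟨C, hC⟩, hr₁0, hr₁1⟩ := ((ev_bd g).and (ev_Ioo zero_lt_one)).exists
  have hC0 := hC.nonneg hr₁0
  have hrN := zpow_pos hr₁0 (-N)
  obtain ⟨M, hM⟩ := exists_pow_lt_of_lt_one (show 0 < 1 / (C * r₁ ^ (-N) + 1) by positivity) hη1
  set ν := η ^ M * (C * r₁ ^ (-N)) with hν
  have hν0 : 0 ≤ ν := by positivity
  have hν1 : ν < 1 := by
    rw [lt_div_iff₀ (by positivity)] at hM
    have : 0 < η ^ M := by positivity
    rw [hν]; linarith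
  set θ₁ : ℝ := ν ^ (((M + 1 : ℕ) : ℝ)⁻¹) with hθ₁
  have hθ₁0 : 0 ≤ θ₁ := Real.rpow_nonneg hν0 _
  have hθ₁p : θ₁ ^ (M + 1) = ν := Real.rpow_inv_natCast_pow hν0 (by omega)
  have hθ₁1 : θ₁ < 1 := Real.rpow_lt_one hν0 hν1 (by positivity)
  have hcont : Tendsto (fun r : ℝ => r ^ (M + 1)) (𝓝[<] 1) (𝓝 1) := by
    have := (continuous_pow (M := ℝ) (M + 1)).tendsto 1
    rw [one_pow] at this
    exact this.mono_left nhdsWithin_le_nhds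
  filter_upwards [ev_Ioo zero_lt_one, hcont.eventually_const_lt hr₁1] with r hr hrM
  have hr0 := hr.1
  refine ⟨max r θ₁, le_max_of_le_right hθ₁0, max_lt hr.2 hθ₁1, fun i => ?_⟩
  rw [coeff_mono_mul, one_mul, coeff_sub, coeff_mono, sub_neg_eq_add]
  rcases lt_trichotomy i 0 with hi | hi | hi
  · rw [if_neg (by omega), sub_zero]
    refine le_max_of_le_right ?_
    refine le_of_pow_le_pow_left₀ (n := M + 1) (by omega) hθ₁0 ?_
    rw [hθ₁p]
    set y := S.abv (S.coeff g (i + N)) with hy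
    have hy0 : 0 ≤ y := S.abv_nonneg _
    have hyη : y ≤ η := h2 _ (by omega)
    have hyC := hC (i + N)
    rw [← hy] at hyC
    have hri : (r ^ i) ^ (M + 1) ≤ r₁ ^ i := by
      have e : (r ^ i) ^ (M + 1) = (r ^ (M + 1)) ^ i := by
        rw [← zpow_natCast, ← zpow_natCast, ← zpow_mul, ← zpow_mul, mul_comm]
      rw [e]
      have := zpow_le_zpow_left₀ (show 0 ≤ -i by omega) hr₁0.le hrM.le
      rw [zpow_neg, zpow_neg] at this
      exact (inv_le_inv₀ (zpow_pos hr₁0 i) (zpow_pos (hr₁0.trans hrM) i)).1 this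
    have e1 : y * r₁ ^ i ≤ C * r₁ ^ (-N) := by
      have := mul_le_mul_of_nonneg_right hyC hrN.le
      rwa [mul_assoc, ← zpow_add₀ hr₁0.ne', show i + N + -N = i by ring] at this
    calc (y * r ^ i) ^ (M + 1) = y ^ M * (y * (r ^ i) ^ (M + 1)) := by rw [mul_pow]; ring
      _ ≤ η ^ M * (y * r₁ ^ i) := by
        apply mul_le_mul (pow_le_pow_left₀ hy0 hyη M) (mul_le_mul_of_nonneg_left hri hy0)
        · exact mul_nonneg hy0 (pow_nonneg (zpow_pos hr0 i).le _)
        · positivity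
      _ ≤ ν := mul_le_mul_of_nonneg_left e1 (by positivity)
  · subst hi
    rw [if_pos (by omega), zero_add, hN, sub_self, abv_zero, zero_mul]
    exact le_max_of_le_right hθ₁0
  · rw [if_neg (by omega), sub_zero]
    refine le_max_of_le_left ?_
    have h3 : r ^ i ≤ r := by
      have := zpow_le_zpow_right_of_le_one₀ hr0 hr.2.le (show 1 ≤ i by omega)
      rwa [zpow_one] at this
    calc _ ≤ 1 * r ^ i := mul_le_mul_of_nonneg_right (h1 _) (zpow_pos hr0 i).le
      _ ≤ r := by rwa [one_mul]

/-- Generalized Weierstrass division. -/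
lemma wdiv {g : S.Γac} (hg : g ∈ En S) (hg0 : g ≠ 0) : ∃ (N : ℤ) (a : S.F), S.coeff g N ≠ 0 ∧
    ∀ (s : Set ℤ) (f : S.Γac), ∃ y : S.Γac,
      proj s (f - mono S a (-N) * proj s y * g) = 0 := by
  obtain ⟨N, hN0, hNmax, η, hη0, hη1, hη⟩ := exists_wdeg hg hg0
  refine ⟨N, (S.coeff g N)⁻¹, hN0, fun s f => ?_⟩
  set b := (S.coeff g N)⁻¹ with hb
  have hbN : S.abv b * S.abv (S.coeff g N) = 1 := abv_inv_mul hN0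
  obtain ⟨y, hy⟩ := solve_outer s (mono S 1 (-N) * (mono S b 0 * g - mono S 1 N)) f
    (small_tail hη0 hη1 (by rw [coeff_mono_mul, sub_zero, hb, inv_mul_cancel₀ hN0])
      (fun i => by
        rw [coeff_mono_mul, sub_zero, S.abv_mul, ← hbN]
        exact mul_le_mul_of_nonneg_left (hNmax i) (S.abv_nonneg _))
      (fun i hi => by
        rw [coeff_mono_mul, sub_zero, S.abv_mul]
        have := mul_le_mul_of_nonneg_left (hη i hi) (S.abv_nonneg b)
        calc _ ≤ _ := this
          _ = η * (S.abv b * S.abv (S.coeff g N)) := by ring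
          _ = η := by rw [hbN, mul_one]))
  have hpy : proj s y = y := by
    apply ext; intro k
    rw [coeff_proj]
    split_ifs with h
    · rfl
    · rw [hy, coeff_proj, if_neg h]
  refine ⟨y, ?_⟩
  rw [hpy]
  have e1 : mono S b (-N) = mono S 1 (-N) * mono S b 0 := by
    rw [mono_mul_mono, one_mul, add_zero]
  have e2 : mono S 1 (-N) * mono S 1 N = (1 : S.Γac) := by
    rw [mono_mul_mono, one_mul, neg_add_cancel, one_eq]
  have e3 : f - mono S b (-N) * y * g =
      (f - mono S 1 (-N) * (mono S b 0 * g - mono S 1 N) * y) - y := by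
    rw [e1]
    linear_combination (-y) * e2
  rw [e3, map_sub, ← hy, hpy, sub_self]

lemma inv_En {g : S.Γac} (hg : g ∈ En S) (hg0 : g ≠ 0) : ∃ q ∈ En S, g * q = 1 := by
  obtain ⟨N, a, -, h⟩ := wdiv hg hg0
  obtain ⟨y, hy⟩ := h Set.univ 1
  have huniv : ∀ x : S.Γac, proj Set.univ x = x := fun x => ext fun i => by
    rw [coeff_proj, if_pos (Set.mem_univ i)]
  rw [huniv, sub_eq_zero] at hy
  refine ⟨_, bounded_of_mul_eq_one hy.symm, ?_⟩
  rw [mul_comm]; exact hy.symm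

lemma wdiv_Om {g : S.Γac} (hg : g ∈ En S) (hgO : g ∈ Om S) (hg0 : g ≠ 0) :
    ∃ N : ℕ, ∀ f ∈ Om S, ∃ q ∈ Om S, ∀ i : ℤ, (N : ℤ) ≤ i → S.coeff (f - q * g) i = 0 := by
  obtain ⟨N, a, hN, h⟩ := wdiv hg hg0
  have hN0 : 0 ≤ N := by
    by_contra hc
    exact hN (hgO N (by omega))
  lift N to ℕ using hN0
  refine ⟨N, fun f _ => ?_⟩
  obtain ⟨y, hy⟩ := h (Set.Ici (N : ℤ)) f
  refine ⟨mono S a (-(N : ℤ)) * proj (Set.Ici (N : ℤ)) y, ?_, fun i hi => ?_⟩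
  · intro i hi
    rw [coeff_mono_mul, coeff_proj, if_neg (by rw [Set.mem_Ici]; omega), mul_zero]
  · have := coeff_proj (Set.Ici (N : ℤ)) (f - mono S a (-(N : ℤ)) * proj (Set.Ici (N : ℤ)) y * g) i
    rw [hy, coeff_zero, if_pos (Set.mem_Ici.2 hi)] at this
    exact this.symm

end ANS

namespace ANS

open Filter Topology

variable {p : ℕ} [Fact p.Prime] {S : AnSetting p}

/-! ### Polynomials -/

/-- The embedding of polynomials. -/
noncomputable def phi (S : AnSetting p) : Polynomial S.F →+* S.Γac :=
  Polynomial.eval₂RingHom S.const S.t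

lemma t_pow (n : ℕ) : S.t ^ n = mono S 1 n := by
  induction n with
  | zero => rw [pow_zero, one_eq]; rfl
  | succ n ih => rw [pow_succ, ih, t_eq, mono_mul_mono, mul_one]; push_cast; rfl

lemma phi_monomial (n : ℕ) (a : S.F) : phi S (Polynomial.monomial n a) = mono S a n := by
  rw [phi, Polynomial.coe_eval₂RingHom, Polynomial.eval₂_monomial, t_pow, const_eq,
    mono_mul_mono, mul_one, zero_add]

lemma coeff_phi (f : Polynomial S.F) (i : ℤ) :
    S.coeff (phi S f) i = if 0 ≤ i then f.coeff i.toNat else 0 := by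
  induction f using Polynomial.induction_on' with
  | add f g hf hg =>
    rw [map_add, S.coeff_add, hf, hg, Polynomial.coeff_add]
    split_ifs <;> simp
  | monomial n a =>
    rw [phi_monomial, coeff_mono, Polynomial.coeff_monomial]
    split_ifs <;> first | rfl | omega

lemma phi_mem_Om (f : Polynomial S.F) : phi S f ∈ Om S := fun i hi => by
  rw [coeff_phi, if_neg (by omega)]

lemma phi_mem_En (f : Polynomial S.F) : phi S f ∈ En S := by
  induction f using Polynomial.induction_on' with
  | add f g hf hg => rw [map_add]; exact add_mem hf hg
  | monomial n a => rw [phi_monomial]; exact mono_mem_En _ _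

lemma exists_phi {x : S.Γac} (hx : x ∈ Om S) (N : ℕ) (h : ∀ i : ℤ, (N : ℤ) ≤ i → S.coeff x i = 0) :
    ∃ f, phi S f = x := by
  refine ⟨∑ j ∈ Finset.range N, Polynomial.monomial j (S.coeff x j), ext fun i => ?_⟩
  rw [coeff_phi]
  split_ifs with hi
  · lift i to ℕ using hi
    rw [Polynomial.finsetSum_coeff]
    simp only [Polynomial.coeff_monomial, Int.toNat_natCast]
    rw [Finset.sum_ite_eq']
    split_ifs with hN
    · rfl
    · rw [Finset.mem_range] at hN
      exact (h i (by omega)).symm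
  · exact (hx i (by omega)).symm

/-! ### Matrices over subrings -/

lemma mul_mem_sub {R : Type*} [CommRing R] (A : Subring R) {n : ℕ} {X Y : Matrix (Fin n) (Fin n) R}
    (hX : ∀ i j, X i j ∈ A) (hY : ∀ i j, Y i j ∈ A) (i j) : (X * Y) i j ∈ A := by
  rw [Matrix.mul_apply]
  exact sum_mem fun k _ => mul_mem (hX i k) (hY k j)

lemma det_adj_mem {R : Type*} [CommRing R] (A : Subring R) {n : ℕ} {X : Matrix (Fin n) (Fin n) R}
    (hX : ∀ i j, X i j ∈ A) : X.det ∈ A ∧ ∀ i j, X.adjugate i j ∈ A := by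
  let X0 : Matrix (Fin n) (Fin n) A := Matrix.of fun i j => ⟨X i j, hX i j⟩
  have e : A.subtype.mapMatrix X0 = X := by ext i j; rfl
  constructor
  · have := A.subtype.map_det X0
    rw [e] at this
    rw [← this]; exact (X0.det).2
  · intro i j
    have := A.subtype.map_adjugate X0
    rw [e] at this
    rw [← this]; exact (X0.adjugate i j).2

lemma one_mem_sub {R : Type*} [CommRing R] (A : Subring R) {n : ℕ} (i j) :
    (1 : Matrix (Fin n) (Fin n) R) i j ∈ A := by
  rw [Matrix.one_apply]
  split_ifs
  · exact one_mem _
  · exact zero_mem _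

/-- Series of Gauss norm at most one on the circle of radius `ρ`. -/
def Bsub (S : AnSetting p) (ρ : ℝ) (hρ : 0 < ρ) : Subring S.Γac where
  carrier := {x | Bd ρ 1 x}
  mul_mem' := fun {x y} hx hy => by
    have := Bd.mul hρ hx hy
    rwa [mul_one] at this
  one_mem' := Bd_one hρ
  add_mem' := fun {x y} hx hy => Bd.add hρ hx hy
  zero_mem' := Bd.zero zero_le_one
  neg_mem' := fun {x} hx => Bd.neg hx

/-- Series of Gauss norm at most `c` on the circle of radius `ρ`. -/
def Bideal (S : AnSetting p) (ρ : ℝ) (hρ : 0 < ρ) (c : ℝ) (hc : 0 ≤ c) :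
    Ideal (Bsub S ρ hρ) where
  carrier := {x | Bd ρ c (x : S.Γac)}
  add_mem' := fun {x y} hx hy => Bd.add hρ hx hy
  zero_mem' := Bd.zero hc
  smul_mem' := fun x y hy => by
    have := Bd.mul hρ x.2 hy
    rw [one_mul] at this
    exact this

lemma det_one_add_ne_zero {n : ℕ} {E : Matrix (Fin n) (Fin n) S.Γac} {ρ c : ℝ} (hρ : 0 < ρ)
    (hc0 : 0 ≤ c) (hc1 : c < 1) (hE : ∀ i j, Bd ρ c (E i j)) : (1 + E).det ≠ 0 := by
  intro hdet
  let B := Bsub S ρ hρ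
  let J := Bideal S ρ hρ c hc0
  let E0 : Matrix (Fin n) (Fin n) B := Matrix.of fun i j => ⟨E i j, (hE i j).mono hc1.le⟩
  have e : B.subtype.mapMatrix (1 + E0) = 1 + E := by
    rw [map_add, map_one]; rfl
  have h0 : (1 + E0).det = 0 := by
    have := B.subtype.map_det (1 + E0)
    rw [e, hdet] at this
    exact Subtype.ext this
  have h1 := (Ideal.Quotient.mk J).map_det (1 + E0)
  have h2 : (Ideal.Quotient.mk J).mapMatrix E0 = 0 := by
    ext i j
    exact Ideal.Quotient.eq_zero_iff_mem.2 (hE i j)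
  rw [map_add, h2, map_one, add_zero, Matrix.det_one, h0, map_zero, eq_comm, ← map_one (Ideal.Quotient.mk J),
    Ideal.Quotient.eq_zero_iff_mem] at h1
  have h3 : Bd ρ c (1 : S.Γac) := h1
  have h4 := h3 0
  rw [S.coeff_one, if_pos rfl, abv_one, zpow_zero, mul_one] at h4
  linarith

/-! ### Step A -/

lemma stepA {n : ℕ} (U Ui : Matrix (Fin n) (Fin n) S.Γac) (hU : U * Ui = 1) :
    ∃ Z : Matrix (Fin n) (Fin n) S.Γac, (∀ i j, Z i j ∈ En S) ∧ (∀ i j, (U * Z) i j ∈ Om S) ∧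
      (U * Z).det ≠ 0 := by
  have hE := ((ev_bd_matrix U).and (ev_bd_matrix Ui)).and (ev_Ioo zero_lt_one)
  obtain ⟨a, ha, hI⟩ := (mem_nhdsLT_iff_exists_Ioo_subset' (zero_lt_one)).1 hE
  obtain ⟨ρ, haρ, hρ1⟩ := exists_between (Set.mem_Iio.1 ha)
  obtain ⟨ρ', hρρ', hρ'1⟩ := exists_between hρ1
  obtain ⟨⟨⟨A, hA0, hA⟩, ⟨D, hD0, hD⟩⟩, hρ0, -⟩ := hI (show ρ ∈ Set.Ioo a 1 from ⟨haρ, hρ1⟩)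
  obtain ⟨⟨-, ⟨D', hD'0, hD'⟩⟩, -, -⟩ :=
    hI (show ρ' ∈ Set.Ioo a 1 from ⟨haρ.trans hρρ', hρ'1⟩)
  set ε : ℝ := 1 / (2 * (A + 1)) with hε
  have hε0 : 0 < ε := by positivity
  have hsm : ∀ i j, ∃ M : ℤ, ∀ k, M ≤ k → S.abv (S.coeff (Ui i j) k) * ρ ^ k < ε :=
    fun i j => small_right hρ0 hρρ' (hD' i j) hε0
  choose Mf hMf using hsm
  obtain ⟨M, hM⟩ : ∃ M : ℤ, ∀ i j, Mf i j ≤ M := by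
    refine ⟨∑ i, ∑ j, |Mf i j|, fun i j => ?_⟩
    calc Mf i j ≤ |Mf i j| := le_abs_self _
      _ ≤ ∑ j, |Mf i j| := Finset.single_le_sum (f := fun j => |Mf i j|) (fun _ _ => abs_nonneg _)
          (Finset.mem_univ j)
      _ ≤ _ := Finset.single_le_sum (f := fun i => ∑ j, |Mf i j|)
          (fun _ _ => Finset.sum_nonneg fun _ _ => abs_nonneg _) (Finset.mem_univ i)
  let Q : Matrix (Fin n) (Fin n) S.Γac := Ui.map (proj (Set.Iic M))
  have hQE : ∀ i j, Q i j ∈ En S := by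
    intro i j
    refine mem_En.2 ⟨D * ρ ^ (-M), fun k => ?_⟩
    have hρM := zpow_pos hρ0 (-M)
    change S.abv (S.coeff (proj (Set.Iic M) (Ui i j)) k) * _ ≤ _
    rw [one_zpow, mul_one, coeff_proj]
    split_ifs with hk
    · have h1 := hD i j k
      have hk' : k ≤ M := hk
      have h2 : (1 : ℝ) ≤ ρ ^ (k - M) := one_le_zpow_of_nonpos₀ hρ0 hρ1.le (by omega)
      have h3 : S.abv (S.coeff (Ui i j) k) * ρ ^ (k - M) ≤ D * ρ ^ (-M) := by
        rw [sub_eq_add_neg, zpow_add₀ hρ0.ne', ← mul_assoc]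
        exact mul_le_mul_of_nonneg_right h1 hρM.le
      have h4 := mul_le_mul_of_nonneg_left h2 (S.abv_nonneg (S.coeff (Ui i j) k))
      linarith
    · rw [abv_zero]; positivity
  let Y := U * Q - 1
  have hYe : Y = U * (Q - Ui) := by rw [Matrix.mul_sub, hU]
  have hQU : ∀ i j, Bd ρ ε ((Q - Ui) i j) := by
    intro i j k
    rw [Matrix.sub_apply, coeff_sub]
    change S.abv (S.coeff (proj (Set.Iic M) (Ui i j)) k - _) * _ ≤ _
    rw [coeff_proj]
    split_ifs with hk
    · rw [sub_self, abv_zero, zero_mul]; exact hε0.le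
    · rw [zero_sub, abv_neg]
      have hk' : ¬ k ≤ M := hk
      exact (hMf i j k ((hM i j).trans (by omega))).le
  have hY : ∀ i j, Bd ρ (1 / 2) (Y i j) := by
    intro i j
    rw [hYe]
    refine (Bd_matrix_mul hρ0 hA0 hε0.le hA hQU i j).mono ?_
    rw [hε, mul_one_div, div_le_div_iff₀ (by positivity) (by positivity)]
    linarith
  obtain ⟨X, hXb, hXs, hXp⟩ := solve_inner Y hρ0 hρ1 (by norm_num) (by norm_num) hY
  have hXE : ∀ i j, X i j ∈ En S := fun i j =>
    mem_En.2 ⟨_, Bd_of_neg_supp hρ0 hρ1.le (hXs i j) (hXb i j)⟩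
  have hUZ : U * (Q * (1 + X)) = 1 + (Y + X + Y * X) := by
    rw [← Matrix.mul_assoc, show U * Q = 1 + Y by simp [Y]]
    noncomm_ring
  refine ⟨Q * (1 + X), mul_mem_sub _ hQE fun i j => ?_, fun i j => ?_, ?_⟩
  · rw [Matrix.add_apply]; exact add_mem (one_mem_sub _ i j) (hXE i j)
  · rw [hUZ, Matrix.add_apply]
    refine add_mem (one_mem_sub _ i j) fun k hk => ?_
    have h1 := coeff_proj (Set.Iio 0) ((Y + X + Y * X) i j) k
    rw [hXp, coeff_zero, if_pos (Set.mem_Iio.2 hk)] at h1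
    exact h1.symm
  · rw [hUZ]
    refine det_one_add_ne_zero (c := 1 / 2) hρ0 (by norm_num) (by norm_num) fun i j => ?_
    rw [Matrix.add_apply, Matrix.add_apply]
    refine ((hY i j).add hρ0 (hXb i j)).add hρ0 ?_
    exact (Bd_matrix_mul hρ0 (by norm_num) (by norm_num) hY hXb i j).mono (by norm_num)

/-! ### Step B -/

lemma pid_gens {R : Type*} [CommRing R] [IsDomain R] [IsPrincipalIdealRing R] {n : ℕ}
    (K : Submodule R (Fin n → R)) : ∃ B : Matrix (Fin n) (Fin n) R, (∀ i, B i ∈ K) ∧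
      ∀ w ∈ K, ∃ c : Fin n → R, w = Matrix.vecMul c B := by
  obtain ⟨m, bas⟩ := Submodule.basisOfPid (Pi.basisFun R (Fin n)) K
  have hmn : m ≤ n := by
    have h1 := Submodule.finrank_le K
    rw [Module.finrank_eq_card_basis bas] at h1
    simpa using h1
  have hinj := Fin.castLE_injective hmn
  refine ⟨Function.extend (Fin.castLE hmn) (fun i => (bas i : Fin n → R)) 0, fun i => ?_,
    fun w hw => ⟨Function.extend (Fin.castLE hmn) (fun i => bas.repr ⟨w, hw⟩ i) 0, ?_⟩⟩
  · by_cases hi : ∃ j, Fin.castLE hmn j = i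
    · obtain ⟨j, rfl⟩ := hi
      rw [hinj.extend_apply]; exact (bas j).2
    · rw [Function.extend_apply' _ _ _ hi]; exact zero_mem _
  · refine Eq.trans ?_ (Matrix.vecMul_eq_sum _ _).symm
    have h1 := congrArg (Subtype.val) (bas.sum_repr ⟨w, hw⟩)
    rw [AddSubmonoidClass.coe_finsetSum] at h1
    refine h1.symm.trans ?_
    refine Fintype.sum_of_injective _ hinj _ _ ?_ ?_
    · intro i hi
      rw [Function.extend_apply' _ _ _ hi]
      simp
    · intro i
      rw [hinj.extend_apply, hinj.extend_apply]; rfl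

lemma stepB {n : ℕ} (V : Matrix (Fin n) (Fin n) S.Γac) (hV : ∀ i j, V i j ∈ Om S)
    (hd : V.det ∈ En S) (hd0 : V.det ≠ 0) :
    ∃ (C D : Matrix (Fin n) (Fin n) S.Γac) (B : Matrix (Fin n) (Fin n) (Polynomial S.F)),
      (∀ i j, C i j ∈ Om S) ∧ (∀ i j, D i j ∈ Om S) ∧ C * D = 1 ∧ D * C = 1 ∧
      V = C * (phi S).mapMatrix B := by
  obtain ⟨hdO, hadj⟩ := det_adj_mem (Om S) hV
  -- a polynomial multiple of the determinant
  obtain ⟨g, q, hq, hg0, hgq⟩ : ∃ (g : Polynomial S.F) (q : S.Γac), q ∈ Om S ∧ phi S g ≠ 0 ∧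
      phi S g = q * V.det := by
    obtain ⟨N, hN⟩ := wdiv_Om hd hdO hd0
    have htN : mono S 1 N ∈ Om S := mono_mem_Om 1 (by positivity)
    obtain ⟨q, hq, hqc⟩ := hN _ htN
    obtain ⟨f, hf⟩ := exists_phi (sub_mem htN (mul_mem hq hdO)) N hqc
    have he : phi S (Polynomial.monomial N 1 - f) = q * V.det := by
      rw [map_sub, hf, phi_monomial, sub_sub_cancel]
    refine ⟨Polynomial.monomial N 1 - f, q, hq, ?_, he⟩
    intro h
    have h1 : S.coeff (phi S (Polynomial.monomial N 1 - f)) N = 1 := by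
      rw [map_sub, coeff_sub, phi_monomial, coeff_mono, if_pos rfl, hf, hqc N le_rfl, sub_zero]
    rw [h, coeff_zero] at h1
    exact zero_ne_one h1
  obtain ⟨N, hN⟩ := wdiv_Om (phi_mem_En g) (phi_mem_Om g) hg0
  have hdiv : ∀ i j, ∃ (w : Polynomial S.F) (z : S.Γac), z ∈ Om S ∧ V i j = phi S w + z * phi S g := by
    intro i j
    obtain ⟨z, hz, hzc⟩ := hN _ (hV i j)
    obtain ⟨w, hw⟩ := exists_phi (sub_mem (hV i j) (mul_mem hz (phi_mem_Om g))) N hzc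
    exact ⟨w, z, hz, by rw [hw]; ring⟩
  choose w z hz hwz using hdiv
  let W : Matrix (Fin n) (Fin n) (Polynomial S.F) := Matrix.of w
  let Z : Matrix (Fin n) (Fin n) S.Γac := Matrix.of z
  have hVWZ : V = (phi S).mapMatrix W + phi S g • Z := by
    ext1 i j
    rw [Matrix.add_apply, Matrix.smul_apply, smul_eq_mul, hwz i j, mul_comm]; rfl
  -- the lattice
  let K : Submodule (Polynomial S.F) (Fin n → Polynomial S.F) :=
    { carrier := {w | ∃ v : Fin n → S.Γac, (∀ i, v i ∈ Om S) ∧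
        (fun i => phi S (w i)) = Matrix.vecMul v V}
      add_mem' := by
        rintro a b ⟨v, hv, hva⟩ ⟨v', hv', hvb⟩
        refine ⟨v + v', fun i => add_mem (hv i) (hv' i), ?_⟩
        rw [Matrix.add_vecMul, ← hva, ← hvb]
        ext1 i
        simp
      zero_mem' := ⟨0, fun _ => zero_mem _, by rw [Matrix.zero_vecMul]; ext1 i; simp⟩
      smul_mem' := by
        rintro c a ⟨v, hv, hva⟩
        refine ⟨phi S c • v, fun i => mul_mem (phi_mem_Om c) (hv i), ?_⟩
        rw [Matrix.smul_vecMul, ← hva]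
        ext1 i
        simp }
  obtain ⟨B, hBK, hBgen⟩ := pid_gens K
  have hKmat : ∀ (A : Matrix (Fin n) (Fin n) (Polynomial S.F)) (E : Matrix (Fin n) (Fin n) S.Γac),
      (∀ i j, E i j ∈ Om S) → (phi S).mapMatrix A = E * V → ∃ C, A = C * B := by
    intro A E hE hA
    have : ∀ i, ∃ c, A i = Matrix.vecMul c B := by
      intro i
      refine hBgen _ ⟨E i, hE i, ?_⟩
      have := congrFun hA i
      rw [Matrix.mul_apply_eq_vecMul] at this
      exact this
    choose c hc using this
    refine ⟨Matrix.of c, ?_⟩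
    ext1 i j
    rw [Matrix.mul_apply_eq_vecMul, hc i]; rfl
  have hqV : phi S g • (1 : Matrix (Fin n) (Fin n) S.Γac) = (q • V.adjugate) * V := by
    rw [Matrix.smul_mul, Matrix.adjugate_mul, smul_smul, hgq]
  have hqadj : ∀ i j, (q • V.adjugate) i j ∈ Om S := fun i j => mul_mem hq (hadj i j)
  obtain ⟨C1, hC1⟩ := hKmat W (1 - Z * (q • V.adjugate))
    (fun i j => by
      rw [Matrix.sub_apply]
      exact sub_mem (one_mem_sub _ i j) (mul_mem_sub _ hz hqadj i j))
    (by
      rw [Matrix.sub_mul, Matrix.one_mul, Matrix.mul_assoc, ← hqV, Matrix.mul_smul, Matrix.mul_one]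
      exact eq_sub_of_add_eq hVWZ.symm)
  obtain ⟨C2, hC2⟩ := hKmat (g • 1) (q • V.adjugate) hqadj (by
    rw [← hqV]
    ext1 i j
    simp [Matrix.one_apply, apply_ite (phi S)])
  have hD : ∀ i, ∃ v : Fin n → S.Γac, (∀ i, v i ∈ Om S) ∧
        (fun j => phi S (B i j)) = Matrix.vecMul v V := fun i => hBK i
  choose D hDO hDV using hD
  have hDV' : (phi S).mapMatrix B = Matrix.of D * V := by
    ext1 i j
    rw [Matrix.mul_apply_eq_vecMul]
    exact congrFun (hDV i) j
  let C := (phi S).mapMatrix C1 + Z * (phi S).mapMatrix C2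
  have hVC : V = C * (phi S).mapMatrix B := by
    rw [Matrix.add_mul, Matrix.mul_assoc, ← map_mul, ← map_mul, ← hC1, ← hC2]
    conv_lhs => rw [hVWZ]
    congr 1
    have : (phi S).mapMatrix (g • (1 : Matrix (Fin n) (Fin n) (Polynomial S.F))) =
        phi S g • (1 : Matrix (Fin n) (Fin n) S.Γac) := by
      ext1 i j
      simp [Matrix.one_apply, apply_ite (phi S)]
    rw [this, Matrix.mul_smul, Matrix.mul_one]
  have hCD : C * Matrix.of D = 1 := by
    obtain ⟨e, -, he⟩ := inv_En hd hd0
    have h1 : (C * Matrix.of D) * V = V := by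
      rw [Matrix.mul_assoc, ← hDV', ← hVC]
    have h2 : V * (e • V.adjugate) = 1 := by
      rw [Matrix.mul_smul, Matrix.mul_adjugate, smul_smul, mul_comm, he, one_smul]
    calc C * Matrix.of D = (C * Matrix.of D) * V * (e • V.adjugate) := by
          rw [Matrix.mul_assoc, h2, Matrix.mul_one]
      _ = 1 := by rw [h1, h2]
  refine ⟨C, Matrix.of D, B, fun i j => ?_, hDO, hCD, mul_eq_one_comm.1 hCD, hVC⟩
  change (phi S).mapMatrix C1 i j + (Z * (phi S).mapMatrix C2) i j ∈ Om S
  exact add_mem (phi_mem_Om _) (mul_mem_sub _ hz (fun i j => phi_mem_Om _) i j)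

end ANS

namespace ANS

variable {p : ℕ} [Fact p.Prime] {S : AnSetting p}

lemma const_mem_Om (a : S.F) : S.const a ∈ Om S := by
  rw [const_eq]; exact mono_mem_Om a le_rfl

lemma const_mem_En (a : S.F) : S.const a ∈ En S := by
  rw [const_eq]; exact mono_mem_En a 0

lemma coeff_matrix_mul {n : ℕ} {X Y : Matrix (Fin n) (Fin n) S.Γac}
    (hX : ∀ i j, X i j ∈ Om S) (hY : ∀ i j, Y i j ∈ Om S) :
    (X * Y).map (fun x => S.coeff x 0) =
      X.map (fun x => S.coeff x 0) * Y.map (fun x => S.coeff x 0) := by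
  ext1 i j
  rw [Matrix.map_apply, Matrix.mul_apply, Matrix.mul_apply, coeff_sum]
  exact Finset.sum_congr rfl fun k _ => coeff_zero_mul (hX i k) (hY k j)

lemma coeff_matrix_one {n : ℕ} :
    (1 : Matrix (Fin n) (Fin n) S.Γac).map (fun x => S.coeff x 0) = 1 := by
  ext1 i j
  rw [Matrix.map_apply, Matrix.one_apply, Matrix.one_apply]
  split_ifs
  · rw [S.coeff_one, if_pos rfl]
  · exact coeff_zero _

lemma main_aux {r : ℕ} (U : Matrix (Fin r) (Fin r) S.Γac) (hU : IsUnit U) :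
    ∃ V W : Matrix (Fin r) (Fin r) S.Γac,
      (∀ i j, V i j ∈ S.omegaAnSet) ∧
      (∀ i j, S.coeff (V i j) 0 = if i = j then 1 else 0) ∧
      (∃ V' : Matrix (Fin r) (Fin r) S.Γac, (∀ i j, V' i j ∈ S.omegaAnSet) ∧
        V * V' = 1 ∧ V' * V = 1) ∧
      (∀ i j, W i j ∈ S.conPSet) ∧
      U = V * W := by
  obtain ⟨Ui, hUi⟩ := hU.exists_right_inv
  obtain ⟨Z, hZ, hUZ, hdet⟩ := stepA U Ui hUi
  have hdU : U.det ∈ En S := by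
    refine bounded_of_mul_eq_one (v := Ui.det) ?_
    rw [← Matrix.det_mul, hUi, Matrix.det_one]
  obtain ⟨hdZ, haZ⟩ := det_adj_mem (En S) hZ
  have hdZ0 : Z.det ≠ 0 := fun h => hdet (by rw [Matrix.det_mul, h, mul_zero])
  obtain ⟨C, D, B, hC, hD, hCD, hDC, hV⟩ := stepB (U * Z) hUZ
    (by rw [Matrix.det_mul]; exact mul_mem hdU hdZ) hdet
  obtain ⟨q, hq, hqZ⟩ := inv_En hdZ hdZ0
  have hZi : Z * (q • Z.adjugate) = 1 := by
    rw [Matrix.mul_smul, Matrix.mul_adjugate, smul_smul, mul_comm, hqZ, one_smul]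
  have hZiE : ∀ i j, (q • Z.adjugate) i j ∈ En S := fun i j => mul_mem hq (haZ i j)
  have hUe : U = C * ((phi S).mapMatrix B * (q • Z.adjugate)) := by
    rw [← Matrix.mul_assoc, ← hV, Matrix.mul_assoc, hZi, Matrix.mul_one]
  have h1 : C.map (fun x => S.coeff x 0) * D.map (fun x => S.coeff x 0) = 1 := by
    rw [← coeff_matrix_mul hC hD, hCD, coeff_matrix_one]
  have h2 : D.map (fun x => S.coeff x 0) * C.map (fun x => S.coeff x 0) = 1 := by
    rw [← coeff_matrix_mul hD hC, hDC, coeff_matrix_one]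
  generalize hC0 : C.map (fun x => S.coeff x 0) = C0 at h1 h2
  generalize hD0 : D.map (fun x => S.coeff x 0) = D0 at h1 h2
  have k1 : S.const.mapMatrix C0 * S.const.mapMatrix D0 = 1 := by rw [← map_mul, h1, map_one]
  have k2 : S.const.mapMatrix D0 * S.const.mapMatrix C0 = 1 := by rw [← map_mul, h2, map_one]
  have hcO : ∀ (X : Matrix (Fin r) (Fin r) S.F) i j, S.const.mapMatrix X i j ∈ Om S :=
    fun X i j => const_mem_Om _
  have hcE : ∀ (X : Matrix (Fin r) (Fin r) S.F) i j, S.const.mapMatrix X i j ∈ En S :=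
    fun X i j => const_mem_En _
  have hcc : (S.const.mapMatrix D0).map (fun x => S.coeff x 0) = D0 := by
    ext1 i j
    change S.coeff (S.const (D0 i j)) 0 = _
    rw [S.coeff_const, if_pos rfl]
  refine ⟨C * S.const.mapMatrix D0,
    S.const.mapMatrix C0 * ((phi S).mapMatrix B * (q • Z.adjugate)),
    mul_mem_sub (Om S) hC (hcO _), fun i j => ?_,
    ⟨S.const.mapMatrix C0 * D, mul_mem_sub (Om S) (hcO _) hD, ?_, ?_⟩,
    mul_mem_sub (En S) (hcE _) (mul_mem_sub (En S) (fun i j => phi_mem_En _) hZiE), ?_⟩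
  · have h3 := congrFun (congrFun (coeff_matrix_mul hC (hcO D0)) i) j
    rw [hcc, hC0, h1, Matrix.map_apply, Matrix.one_apply] at h3
    rw [h3]
  · rw [Matrix.mul_assoc, ← Matrix.mul_assoc _ _ D, k2, Matrix.one_mul, hCD]
  · rw [Matrix.mul_assoc, ← Matrix.mul_assoc D, hDC, Matrix.one_mul, k1]
  · rw [Matrix.mul_assoc, ← Matrix.mul_assoc _ (S.const.mapMatrix C0), k2, Matrix.one_mul]
    exact hUe

end ANS

/-- Let `U` be an invertible matrix over `Γ_{an,con}`.  Then there exist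
a matrix `V = 1 + ∑_{n≥1} Vₙ tⁿ` with entries in `Ω_an` which is invertible over `Ω_an`,
and a matrix `W` with entries in `Γ_con[1/p]`, such that `U = V · W`. -/
theorem anCon_invertible_matrix_factorization {p : ℕ} [Fact p.Prime] (S : AnSetting p)
    {r : ℕ} (U : Matrix (Fin r) (Fin r) S.Γac) (hU : IsUnit U) :
    ∃ V W : Matrix (Fin r) (Fin r) S.Γac,
      -- `V` has entries in `Ω_an` and constant term the identity matrix
      (∀ i j, V i j ∈ S.omegaAnSet) ∧
      (∀ i j, S.coeff (V i j) 0 = if i = j then 1 else 0) ∧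
      -- `V` is invertible over `Ω_an`
      (∃ V' : Matrix (Fin r) (Fin r) S.Γac, (∀ i j, V' i j ∈ S.omegaAnSet) ∧
        V * V' = 1 ∧ V' * V = 1) ∧
      -- `W` has entries in `Γ_con[1/p]`
      (∀ i j, W i j ∈ S.conPSet) ∧
      U = V * W := by
  exact ANS.main_aux U hU
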